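/- Let n ≥ 21, d = 3n+2, let Ψ be the Clebsch covariant of degree d, and set g := m₁^d + m₂^d + … + m₉^d where m₁ = x₁+3x₂+9x₃, m₂ = −10x₁+x₂+4x₃, m₃ = 8x₁+4x₂+6x₃, m₄ = x₁+6x₂−10x₃, m₅ = 4x₁−8x₂−10x₃, m₆ = −3x₁+7x₂−4x₃, m₇ = −3x₂+2x₃, m₈ = 8x₁−4x₂−4x₃, m₉ = −10x₁+4x₂+6x₃. Then the set {Ψ(h,g,g,g) : h ∈ L_T} ∪ {Ψ(g,g,g,g)} spans the 45-dimensional space V(8). -/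

import Mathlib

open MvPolynomial

noncomputable section

/-- The polynomial ring ℂ[x₁,x₂,x₃]. -/
abbrev MvP : Type := MvPolynomial (Fin 3) ℂ

/-- The linear form a₁x₁+a₂x₂+a₃x₃ with coefficient vector a. -/
def lin (a : Fin 3 → ℂ) : MvP := ∑ i, C (a i) * X i

lemma lin_hom (a : Fin 3 → ℂ) : (lin a).IsHomogeneous 1 := by
  unfold lin
  apply IsHomogeneous.sum
  intro i _
  simpa using (isHomogeneous_C (Fin 3) (a i)).mul (isHomogeneous_X ℂ i)

/-- V(k): the space of homogeneous polynomials of degree k in ℂ[x₁,x₂,x₃]. -/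
def V (k : ℕ) : Submodule ℂ MvP := homogeneousSubmodule (Fin 3) ℂ k

/-- l^d as an element of V(d), where l is the linear form with coefficient vector a. -/
def powV (d : ℕ) (a : Fin 3 → ℂ) : V d :=
  ⟨lin a ^ d, by rw [V, mem_homogeneousSubmodule]; simpa using (lin_hom a).pow d⟩

/-- The bracket (l₁l₂l₃) = det(vec l₁, vec l₂, vec l₃). -/
def br (a b c : Fin 3 → ℂ) : ℂ := Matrix.det (Matrix.of ![a, b, c])

/-- I(l₁,l₂,l₃,l₄) = (l₁l₂l₃)(l₁l₂l₄)(l₁l₃l₄)(l₂l₃l₄). -/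
def Icov (a b c d : Fin 3 → ℂ) : ℂ := br a b c * br a b d * br a c d * br b c d

/-- l₁l₂l₃l₄ as an element of V(4). -/
def prod4 (a b c d : Fin 3 → ℂ) : V 4 :=
  ⟨lin a * lin b * lin c * lin d, by
    rw [V, mem_homogeneousSubmodule]
    simpa using (((lin_hom a).mul (lin_hom b)).mul (lin_hom c)).mul (lin_hom d)⟩

/-- l₁²l₂²l₃²l₄² as an element of V(8). -/
def prod4sq (a b c d : Fin 3 → ℂ) : V 8 :=
  ⟨lin a ^ 2 * lin b ^ 2 * lin c ^ 2 * lin d ^ 2, by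
    rw [V, mem_homogeneousSubmodule]
    simpa using ((((lin_hom a).pow 2).mul ((lin_hom b).pow 2)).mul ((lin_hom c).pow 2)).mul
      ((lin_hom d).pow 2)⟩

/-- Φ is a Clebsch covariant of degree d = 3n+1: a symmetric quadrilinear map
V(d)⁴ → V(4) with Φ(l₁^d,l₂^d,l₃^d,l₄^d) = I(l₁,l₂,l₃,l₄)^n · l₁l₂l₃l₄. -/
def IsClebschS (n : ℕ) (Φ : MultilinearMap ℂ (fun _ : Fin 4 => V (3*n+1)) (V 4)) : Prop :=
  (∀ (v : Fin 4 → V (3*n+1)) (σ : Equiv.Perm (Fin 4)), Φ (v ∘ σ) = Φ v) ∧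
  (∀ a b c d : Fin 3 → ℂ,
    Φ ![powV (3*n+1) a, powV (3*n+1) b, powV (3*n+1) c, powV (3*n+1) d]
      = (Icov a b c d) ^ n • prod4 a b c d)

/-- Ψ is a Clebsch covariant of degree d = 3n+2: a symmetric quadrilinear map
V(d)⁴ → V(8) with Ψ(l₁^d,l₂^d,l₃^d,l₄^d) = I(l₁,l₂,l₃,l₄)^n · l₁²l₂²l₃²l₄². -/
def IsClebschT (n : ℕ) (Ψ : MultilinearMap ℂ (fun _ : Fin 4 => V (3*n+2)) (V 8)) : Prop :=
  (∀ (v : Fin 4 → V (3*n+2)) (σ : Equiv.Perm (Fin 4)), Ψ (v ∘ σ) = Ψ v) ∧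
  (∀ a b c d : Fin 3 → ℂ,
    Ψ ![powV (3*n+2) a, powV (3*n+2) b, powV (3*n+2) c, powV (3*n+2) d]
      = (Icov a b c d) ^ n • prod4sq a b c d)

/-- Membership in L_S = x₁^{2n+3}·V(n−2): a homogeneous form of degree 3n+1 lies in L_S
iff it is divisible by x₁^{2n+3}. -/
def memLS (n : ℕ) (h : V (3*n+1)) : Prop := (X 0 : MvP) ^ (2*n+3) ∣ (h : MvP)

/-- Membership in L_T = x₁^{2n+5}·V(n−3): a homogeneous form of degree 3n+2 lies in L_T
iff it is divisible by x₁^{2n+5}. -/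
def memLT (n : ℕ) (h : V (3*n+2)) : Prop := (X 0 : MvP) ^ (2*n+5) ∣ (h : MvP)

/-- The Lagrange interpolation polynomial p_i^b of degree K−1 evaluated at c. -/
def interp {K : ℕ} (b : Fin K → ℂ) (i : Fin K) (c : ℂ) : ℂ :=
  ∏ j ∈ Finset.univ.erase i, (c - b j) / (b i - b j)

/-- f(c) = Σᵢ p_i^b(c)·l_i^d − (cx₁+y)^d where y = λx₂+μx₃ and l_i = b_i x₁ + y. -/
def fc {K : ℕ} (d : ℕ) (b : Fin K → ℂ) (lam mu c : ℂ) : MvP :=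
  ∑ i, C (interp b i c) * lin ![b i, lam, mu] ^ d - lin ![c, lam, mu] ^ d

/-- f(c) as an element of V(d). -/
def fcV {K : ℕ} (d : ℕ) (b : Fin K → ℂ) (lam mu c : ℂ) : V d :=
  ∑ i, interp b i c • powV d ![b i, lam, mu] - powV d ![c, lam, mu]

/-- The bracket (l₁l₂l₃) over an arbitrary commutative ring. -/
def brR {R : Type*} [CommRing R] (a b c : Fin 3 → R) : R := Matrix.det (Matrix.of ![a, b, c])

/-- I(l₁,l₂,l₃,l₄) over an arbitrary commutative ring. -/
def IcovR {R : Type*} [CommRing R] (a b c d : Fin 3 → R) : R :=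
  brR a b c * brR a b d * brR a c d * brR b c d

/-- The binomial coefficient polynomial X(X−1)⋯(X−m+1)/m! over ℂ. -/
def binomPoly (m : ℕ) : Polynomial ℂ :=
  Polynomial.C ((m.factorial : ℂ))⁻¹ * ∏ i ∈ Finset.range m, (Polynomial.X - Polynomial.C (i : ℂ))

/-- The mod-p binomial coefficient polynomial X(X−1)⋯(X−m+1)/m!. -/
def binomPolyZMod (p m : ℕ) : Polynomial (ZMod p) :=
  Polynomial.C ((m.factorial : ZMod p))⁻¹ *
    ∏ i ∈ Finset.range m, (Polynomial.X - Polynomial.C (i : ZMod p))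

/-- c·x₁ + λx₂ + μx₃ as an element of (ℂ[x₁,x₂,x₃])[c]. -/
def cLin (lam mu : ℂ) : Polynomial MvP :=
  Polynomial.X * Polynomial.C (X 0) + Polynomial.C (C lam * X 1 + C mu * X 2)

/-- G_n = −24 Σ_{i<k<p} I(cx₁+y, m_i, m_k, m_p)^n·(cx₁+y)·m_i m_k m_p ∈ ℂ[c,x₁,x₂,x₃],
viewed as a polynomial in c with coefficients in ℂ[x₁,x₂,x₃]. -/
def Gpoly {N : ℕ} (m : Fin N → Fin 3 → ℂ) (lam mu : ℂ) (n : ℕ) : Polynomial MvP :=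
  (-24 : Polynomial MvP) *
    ∑ i, ∑ k, ∑ p,
      if i < k ∧ k < p then
        Polynomial.map (MvPolynomial.C)
          ((IcovR ![Polynomial.X, Polynomial.C lam, Polynomial.C mu]
            (fun j => Polynomial.C (m i j)) (fun j => Polynomial.C (m k j))
            (fun j => Polynomial.C (m p j))) ^ n)
        * cLin lam mu * Polynomial.C (lin (m i) * lin (m k) * lin (m p))
      else 0

/-- The nine linear forms m₁,…,m₉ (coefficient vectors). -/
def ms : Fin 9 → Fin 3 → ℂ :=
  ![![1, 3, 9], ![-10, 1, 4], ![8, 4, 6],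
    ![1, 6, -10], ![4, -8, -10], ![-3, 7, -4],
    ![0, -3, 2], ![8, -4, -4], ![-10, 4, 6]]

instance f11 : Fact (Nat.Prime 11) := ⟨by norm_num⟩
def tab : List (ℕ × List (ℕ × ℕ × ℕ)) :=
  [(1, [(0, 5, 8), (0, 7, 8), (1, 2, 3), (1, 6, 8), (3, 4, 5), (3, 4, 7)]),
   (2, [(0, 1, 3), (0, 3, 4), (1, 2, 6), (2, 4, 6)]),
   (3, [(0, 2, 4), (1, 3, 5), (1, 3, 7), (2, 3, 5), (2, 3, 7), (3, 4, 6)]),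
   (4, [(3, 5, 6), (3, 6, 7)]),
   (5, [(0, 3, 8), (2, 4, 5), (2, 4, 7), (5, 6, 8), (6, 7, 8)]),
   (6, [(0, 1, 5), (0, 1, 7), (0, 3, 5), (0, 3, 7)]),
   (7, [(0, 2, 5), (0, 2, 7), (2, 3, 4)]),
   (8, [(0, 2, 3), (0, 4, 8), (1, 3, 8), (2, 3, 6), (4, 6, 8)]),
   (9, [(1, 2, 5), (1, 2, 7), (3, 4, 8), (4, 5, 6), (4, 6, 7)]),
   (10, [(0, 1, 2), (0, 4, 5), (0, 4, 7), (1, 3, 6), (1, 5, 8), (1, 7, 8), (2, 5, 6), (2, 6, 7), (3, 5, 8), (3, 7, 8), (4, 5, 8), (4, 7, 8)])]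

/-- vectors mod 11 as naturals -/
structure V3 where
  a : ℕ
  b : ℕ
  c : ℕ

def mv : ℕ → V3 := fun i =>
  Nat.rec ⟨1,3,9⟩ (fun i _ => Nat.rec ⟨1,1,4⟩ (fun i _ => Nat.rec ⟨8,4,6⟩ (fun i _ =>
  Nat.rec ⟨1,6,1⟩ (fun i _ => Nat.rec ⟨4,3,1⟩ (fun i _ => Nat.rec ⟨8,7,7⟩ (fun i _ =>
  Nat.rec ⟨0,8,2⟩ (fun i _ => Nat.rec ⟨8,7,7⟩ (fun _ _ => ⟨1,4,6⟩) i) i) i) i) i) i) i) i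

def BB : ℕ := Nat.pow 11 104
def BB9 : ℕ := Nat.pow BB 9

def m11 (x : ℕ) : ℕ := Nat.mod x 11

/-- det((1,0,0),u,v) -/
def dA (u v : V3) : ℕ := m11 (Nat.add (Nat.mul u.b v.c) (Nat.mul 10 (Nat.mul u.c v.b)))
/-- det((0,1,mu),u,v) -/
def dB (mu : ℕ) (u v : V3) : ℕ :=
  m11 (Nat.add (Nat.add (Nat.mul u.c v.a) (Nat.mul 10 (Nat.mul u.a v.c)))
    (Nat.mul mu (Nat.add (Nat.mul u.a v.b) (Nat.mul 10 (Nat.mul u.b v.a)))))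
def inv11 (x : ℕ) : ℕ := m11 (Nat.pow x 9)

def kE (u : V3) : ℕ := Nat.add u.a (Nat.add (Nat.mul u.b BB) (Nat.mul u.c BB9))
def kT (u v w : V3) : ℕ := Nat.pow (Nat.mul (kE u) (Nat.mul (kE v) (kE w))) 2

/-- one step of recursion; y1,y2,y3 previous -/
def ystep (r a1 a2 a3 s y1 y2 y3 : ℕ) : ℕ :=
  m11 (Nat.mul (inv11 s) (Nat.add (Nat.mul (Nat.mul a1 (m11 (Nat.add r (Nat.add 1 (Nat.mul 10 s))))) y1)
    (Nat.add (Nat.mul (Nat.mul a2 (m11 (Nat.add (Nat.mul 2 r) (Nat.add 2 (Nat.mul 10 s))))) y2)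
      (Nat.mul (Nat.mul a3 (m11 (Nat.add (Nat.mul 3 r) (Nat.add 3 (Nat.mul 10 s))))) y3))))

def dstep (r a1 a2 a3 s y1 y2 y3 d1 d2 d3 : ℕ) : ℕ :=
  m11 (Nat.add (ystep r a1 a2 a3 s d1 d2 d3) (Nat.mul (inv11 s)
    (Nat.add (Nat.mul a1 y1) (Nat.add (Nat.mul 2 (Nat.mul a2 y2)) (Nat.mul 3 (Nat.mul a3 y3))))))

/-- list of y_s, from s on (k more terms). -/
def yl (r a1 a2 a3 : ℕ) (k : ℕ) : ℕ → ℕ → ℕ → ℕ → List ℕ :=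
  Nat.rec (fun _ _ _ _ => []) (fun _ ih s y1 y2 y3 =>
    (fun y => y :: ih (Nat.succ s) y y1 y2) (ystep r a1 a2 a3 s y1 y2 y3)) k

def dl (r a1 a2 a3 : ℕ) (k : ℕ) : ℕ → ℕ → ℕ → ℕ → ℕ → ℕ → ℕ → List ℕ :=
  Nat.rec (fun _ _ _ _ _ _ _ => []) (fun _ ih s y1 y2 y3 d1 d2 d3 =>
    (fun y d => d :: ih (Nat.succ s) y y1 y2 d d1 d2) (ystep r a1 a2 a3 s y1 y2 y3)
      (dstep r a1 a2 a3 s y1 y2 y3 d1 d2 d3)) k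

/-- acc + c * ys -/
def axpy (c : ℕ) (ys : List ℕ) : List ℕ → List ℕ :=
  List.rec (fun _ => []) (fun y _ ih acc => List.rec [] (fun a as _ =>
    Nat.add a (Nat.mul c y) :: ih as) acc) ys

def z11 : List ℕ := [0,0,0,0,0,0,0,0,0,0,0]

def tl (du : Bool) (r mu : ℕ) (u v w : V3) : List ℕ :=
  (fun q1 q2 q3 =>
    (fun a1 a2 a3 => Bool.rec (1 :: yl r a1 a2 a3 10 1 1 0 0) (0 :: dl r a1 a2 a3 10 1 1 0 0 0 0 0) du)
      (m11 (Nat.add q1 (Nat.add q2 q3)))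
      (m11 (Nat.add (Nat.mul q1 q2) (Nat.add (Nat.mul q1 q3) (Nat.mul q2 q3))))
      (m11 (Nat.mul q1 (Nat.mul q2 q3))))
    (m11 (Nat.mul (dB mu u v) (inv11 (dA u v))))
    (m11 (Nat.mul (dB mu u w) (inv11 (dA u w))))
    (m11 (Nat.mul (dB mu v w) (inv11 (dA v w))))

def gtab (du : Bool) (r mu : ℕ) (l : List (ℕ × ℕ × ℕ)) : List ℕ :=
  List.rec z11 (fun t _ ih => axpy (kT (mv t.1) (mv t.2.1) (mv t.2.2)) (tl du r mu (mv t.1) (mv t.2.1) (mv t.2.2)) ih) l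

/-- R_s for rho : list of length 11 -/
def Rl (du : Bool) (r mu rho : ℕ) (T : List (ℕ × List (ℕ × ℕ × ℕ))) : List ℕ :=
  List.rec z11 (fun t _ ih => axpy (m11 (Nat.pow t.1 rho)) (gtab du r mu t.2) ih) T

/-- convolution with (1+t u)^2 -/
def conv (U U2 : ℕ) (l : List ℕ) : ℕ → ℕ → List ℕ :=
  List.rec (fun _ _ => []) (fun x _ ih x1 x2 =>
    Nat.add x (Nat.add (Nat.mul U2 x1) (Nat.mul (Nat.mul U U) x2)) :: ih x x1) l

def uu (mu : ℕ) : ℕ := Nat.add BB (Nat.mul mu BB9)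

def rowsMu (du : Bool) (r rho mu : ℕ) : List ℕ :=
  conv (uu mu) (Nat.mul 2 (uu mu)) (Rl du r mu rho tab) 0 0

/-- select rows -/
def selRows (r rho mu : ℕ) : List ℕ :=
  ((rowsMu false r rho mu).take (3*r+3) ++ Bool.rec ((rowsMu true r rho mu).drop (3*r+3)) [] (Nat.ble 3 r)).drop mu

def allRows (r rho : ℕ) : List ℕ :=
  selRows r rho 5 ++ (selRows r rho 4 ++ (selRows r rho 3 ++ (selRows r rho 2 ++ (selRows r rho 1 ++ selRows r rho 0))))

def divAll (rs : List ℕ) : List ℕ := List.rec [] (fun r _ ih => Nat.div r BB :: ih) rs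

def redAll (pv : ℕ) (rs acc : List ℕ) : List ℕ :=
  List.rec acc (fun r _ ih => Nat.div (Nat.add r (Nat.mul (m11 r) pv)) BB :: ih) rs

/-- find a pivot and continue with k -/
def step (k : List ℕ → Bool) (rs : List ℕ) : List ℕ → Bool :=
  List.rec (fun _ => false) (fun r rs ih acc =>
    Nat.rec (ih (Nat.div r BB :: acc)) (fun j _ => k (redAll (Nat.mul (m11 (Nat.mul 10 (Nat.pow (Nat.succ j) 9))) r) rs acc)) (m11 r)) rs

def elim (prog : List Bool) : List ℕ → Bool :=
  List.rec (fun _ => true) (fun b _ ih rs => Bool.rec (ih (divAll rs)) (step ih rs []) b) prog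

def prog : List Bool :=
  [true,true,true,true,true,true,true,true,true,
   true,true,true,true,true,true,true,true,false,
   true,true,true,true,true,true,true,false,false,
   true,true,true,true,true,true,false,false,false,
   true,true,true,true,true,false,false,false,false,
   true,true,true,true,false,false,false,false,false,
   true,true,true,false,false,false,false,false,false,
   true,true,false,false,false,false,false,false,false,
   true]

def chk (r rho : ℕ) : Bool := elim prog (allRows r rho)

def chkR (r : ℕ) : Bool := Bool.and (chk r 0) (Bool.and (chk r 1) (Bool.and (chk r 2) (Bool.and (chk r 3) (Bool.and (chk r 4)
 (Bool.and (chk r 5) (Bool.and (chk r 6) (Bool.and (chk r 7) (Bool.and (chk r 8) (chk r 9)))))))))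


section Elim
open Polynomial

abbrev LL := AddMonoidHom (Polynomial ℕ) (ZMod 11)

def sh (Λ : LL) : LL := Λ.comp (AddMonoidHom.mulLeft (Polynomial.X : Polynomial ℕ))

lemma sh_apply (Λ : LL) (f : Polynomial ℕ) : sh Λ f = Λ (Polynomial.X * f) := rfl

def Good (b : ℕ) (Λ : LL) (x : ℕ) : Prop :=
  ∃ f : Polynomial ℕ, f.eval BB = x ∧ f.eval 1 ≤ b ∧ Λ f = 0

lemma BB_mod : BB % 11 = 0 := by decide +kernel
lemma BB_pos : 0 < BB := by decide +kernel

lemma LC (Λ : LL) (a : ℕ) : Λ (Polynomial.C a) = a * Λ 1 := by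
  have : (Polynomial.C a : Polynomial ℕ) = a • (1 : Polynomial ℕ) := by
    rw [nsmul_eq_mul, mul_one]; simp
  rw [this, map_nsmul, nsmul_eq_mul]

lemma good_div (b : ℕ) (hb : b < BB) (Λ : LL) (f : Polynomial ℕ) (hf : f.eval 1 ≤ b)
    (hΛ : Λ f = 0) (h0 : (f.coeff 0 : ZMod 11) * Λ 1 = 0) :
    Good b (sh Λ) (f.eval BB / BB) := by
  have e := Polynomial.X_mul_divX_add f
  have e1 : f.eval 1 = f.divX.eval 1 + f.coeff 0 := by
    conv_lhs => rw [← e]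
    simp
  have e2 : f.eval BB = BB * f.divX.eval BB + f.coeff 0 := by
    conv_lhs => rw [← e]
    simp
  refine ⟨f.divX, ?_, by omega, ?_⟩
  · rw [e2, Nat.add_comm, Nat.add_mul_div_left _ _ BB_pos, Nat.div_eq_of_lt (by omega), zero_add]
  · rw [← e, map_add, LC, h0, add_zero] at hΛ
    rw [sh_apply]; exact hΛ

lemma eval_mod (f : Polynomial ℕ) : f.eval BB % 11 = f.coeff 0 % 11 := by
  conv_lhs => rw [← Polynomial.X_mul_divX_add f]
  simp [Nat.add_mod, Nat.mul_mod, BB_mod]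

lemma Good.mono {b b' : ℕ} (h : b ≤ b') {Λ : LL} {x : ℕ} (hx : Good b Λ x) : Good b' Λ x := by
  obtain ⟨f, h1, h2, h3⟩ := hx
  exact ⟨f, h1, h2.trans h, h3⟩

lemma z11_pow10 : ∀ x : ZMod 11, x ≠ 0 → 10 * x ^ 9 * x = -1 := by decide +kernel

lemma good_zero {b : ℕ} (hb : b < BB) {Λ : LL} {x : ℕ} (hx : Good b Λ x)
    (h : x % 11 = 0 ∨ Λ 1 = 0) : Good b (sh Λ) (x / BB) := by
  obtain ⟨f, rfl, h2, h3⟩ := hx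
  refine good_div b hb Λ f h2 h3 ?_
  rcases h with h | h
  · rw [eval_mod] at h
    have : ((f.coeff 0 : ℕ) : ZMod 11) = 0 := by
      rw [ZMod.natCast_eq_zero_iff]; omega
    rw [this, zero_mul]
  · rw [h, mul_zero]

lemma good_red {b : ℕ} (hb : 101 * b < BB) {Λ : LL} {x p j : ℕ} (hx : Good b Λ x) (hp : Good b Λ p)
    (hj : p % 11 = j + 1) :
    Good (101 * b) (sh Λ) ((x + x % 11 * ((10 * (j + 1) ^ 9) % 11 * p)) / BB) := by
  obtain ⟨f, rfl, h2, h3⟩ := hx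
  obtain ⟨g, rfl, h2', h3'⟩ := hp
  set c := f.eval BB % 11 * ((10 * (j + 1) ^ 9) % 11) with hc
  have hc100 : c ≤ 100 := by
    have h1 : f.eval BB % 11 ≤ 10 := by omega
    have h2 : (10 * (j + 1) ^ 9) % 11 ≤ 10 := by omega
    calc c ≤ 10 * 10 := Nat.mul_le_mul h1 h2
      _ = 100 := rfl
  have key : f.eval BB + f.eval BB % 11 * ((10 * (j + 1) ^ 9) % 11 * g.eval BB)
      = (f + Polynomial.C c * g).eval BB := by
    simp [hc, mul_assoc]
  rw [key]
  have hcg : (f + Polynomial.C c * g).eval 1 ≤ 101 * b := by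
    simp only [Polynomial.eval_add, Polynomial.eval_mul, Polynomial.eval_C]
    have := Nat.mul_le_mul hc100 h2'
    omega
  have hL : Λ (f + Polynomial.C c * g) = 0 := by
    have : (Polynomial.C c * g : Polynomial ℕ) = c • g := by
      rw [nsmul_eq_mul]; simp
    rw [this, map_add, map_nsmul, h3, h3']; simp
  refine good_div _ hb Λ _ hcg hL ?_
  have hg0 : ((g.coeff 0 : ℕ) : ZMod 11) = ((j + 1 : ℕ) : ZMod 11) := by
    rw [ZMod.natCast_eq_natCast_iff', ← eval_mod, hj]
    omega
  have hj0 : ((j + 1 : ℕ) : ZMod 11) ≠ 0 := by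
    rw [Ne, ZMod.natCast_eq_zero_iff]
    have : j + 1 < 11 := by omega
    omega
  have : (((f + Polynomial.C c * g).coeff 0 : ℕ) : ZMod 11) = 0 := by
    simp only [Polynomial.coeff_add, Polynomial.coeff_C_mul, hc, Nat.cast_add, Nat.cast_mul, hg0,
      eval_mod, ZMod.natCast_mod]
    have := z11_pow10 _ hj0
    push_cast at this ⊢
    linear_combination (f.coeff 0 : ZMod 11) * this
  rw [this, zero_mul]

lemma divAll_good {b : ℕ} (hb : b < BB) {Λ : LL} (h1 : Λ 1 = 0) (rs : List ℕ)
    (h : ∀ x ∈ rs, Good b Λ x) : ∀ x ∈ divAll rs, Good b (sh Λ) x := by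
  induction rs with
  | nil => intro x hx; exact absurd hx (by simp [divAll])
  | cons r rs ih =>
    have : divAll (r :: rs) = (r / BB) :: divAll rs := rfl
    rw [this]
    intro x hx
    rcases List.mem_cons.1 hx with rfl | hx
    · exact good_zero hb (h r (by simp)) (Or.inr h1)
    · exact ih (fun y hy => h y (by simp [hy])) x hx

lemma redAll_good {b : ℕ} (hb : 101 * b < BB) {Λ : LL} {p j : ℕ} (hp : Good b Λ p)
    (hj : p % 11 = j + 1) (rs acc : List ℕ)
    (h : ∀ x ∈ rs, Good b Λ x) (hacc : ∀ x ∈ acc, Good (101 * b) (sh Λ) x) :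
    ∀ x ∈ redAll (10 * (j + 1) ^ 9 % 11 * p) rs acc, Good (101 * b) (sh Λ) x := by
  induction rs with
  | nil => exact hacc
  | cons r rs ih =>
    have : redAll (10 * (j + 1) ^ 9 % 11 * p) (r :: rs) acc
      = ((r + r % 11 * ((10 * (j + 1) ^ 9) % 11 * p)) / BB)
        :: redAll (10 * (j + 1) ^ 9 % 11 * p) rs acc := rfl
    rw [this]
    intro x hx
    rcases List.mem_cons.1 hx with rfl | hx
    · exact good_red hb (h r (by simp)) hp hj
    · exact ih (fun y hy => h y (by simp [hy])) x hx

lemma step_good {b : ℕ} (hb : 101 * b < BB) {Λ : LL} (k : List ℕ → Bool) (rs : List ℕ) :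
    ∀ acc : List ℕ, (∀ x ∈ rs, Good b Λ x) → (∀ x ∈ acc, Good (101 * b) (sh Λ) x) →
    step k rs acc = true → ∃ p, Good b Λ p ∧ p % 11 ≠ 0 ∧ ∃ rs', (∀ x ∈ rs', Good (101 * b) (sh Λ) x)
      ∧ k rs' = true := by
  induction rs with
  | nil => intro acc _ _ h; exact absurd h (by simp [step])
  | cons r rs ih =>
    intro acc h hacc hs
    have e : step k (r :: rs) acc = Nat.rec (motive := fun _ => Bool) (step k rs (r / BB :: acc))
      (fun j _ => k (redAll (10 * (j + 1) ^ 9 % 11 * r) rs acc)) (r % 11) := rfl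
    rw [e] at hs
    rcases hr : r % 11 with _ | j
    · rw [hr] at hs
      refine ih _ (fun y hy => h y (by simp [hy])) ?_ hs
      intro x hx
      rcases List.mem_cons.1 hx with rfl | hx
      · exact (good_zero (by omega) (h r (by simp)) (Or.inl hr)).mono (by omega)
      · exact hacc x hx
    · rw [hr] at hs
      exact ⟨r, h r (by simp), by omega, _, redAll_good hb (h r (by simp)) hr rs acc
        (fun y hy => h y (by simp [hy])) hacc, hs⟩

lemma L_ext (Λ : LL) (h : ∀ i, Λ (Polynomial.X ^ i) = 0) (f : Polynomial ℕ) : Λ f = 0 := by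
  have : Λ = 0 := by
    apply Polynomial.addHom_ext
    intro n a
    have : (Polynomial.monomial n a : Polynomial ℕ) = a • (Polynomial.X ^ n) := by
      rw [← Polynomial.C_mul_X_pow_eq_monomial, nsmul_eq_mul]; simp
    rw [this, map_nsmul, h]; simp
  rw [this]; rfl

lemma elim_sound (pr : List Bool) : ∀ (b : ℕ) (Λ : LL) (rs : List ℕ),
    b * 101 ^ (pr.count true) < BB → (∀ x ∈ rs, Good b Λ x) →
    (∀ i, pr.getD i false = false → Λ (Polynomial.X ^ i) = 0) → elim pr rs = true →
    ∀ f, Λ f = 0 := by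
  induction pr with
  | nil =>
    intro b Λ rs _ _ h _
    exact L_ext Λ (fun i => h i (by simp))
  | cons c pr ih =>
    intro b Λ rs hb hrs hv he
    have hv' : ∀ i, pr.getD i false = false → sh Λ (Polynomial.X ^ i) = 0 := by
      intro i hi
      rw [sh_apply, ← pow_succ']
      exact hv (i + 1) (by simpa using hi)
    have fin : Λ 1 = 0 → (∀ f, sh Λ f = 0) → ∀ f, Λ f = 0 := by
      intro h1 h2 f
      rw [← Polynomial.X_mul_divX_add f, map_add, LC, h1, ← sh_apply, h2]; simp
    cases c with
    | false =>
      have h1 : Λ 1 = 0 := by simpa using hv 0 (by simp)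
      have e : elim (false :: pr) rs = elim pr (divAll rs) := rfl
      rw [e] at he
      have hc : (false :: pr).count true = pr.count true := by simp
      rw [hc] at hb
      have hb' : b < BB := lt_of_le_of_lt (Nat.le_mul_of_pos_right _ (by positivity)) hb
      exact fin h1 (ih b (sh Λ) _ hb (divAll_good hb' h1 rs hrs) hv' he)
    | true =>
      have e : elim (true :: pr) rs = step (elim pr) rs [] := rfl
      rw [e] at he
      have hc : (true :: pr).count true = pr.count true + 1 := by simp
      rw [hc] at hb
      have hb2 : 101 * b * 101 ^ pr.count true < BB := by
        calc _ = b * 101 ^ (pr.count true + 1) := by ring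
          _ < BB := hb
      have hb1 : 101 * b < BB := lt_of_le_of_lt (Nat.le_mul_of_pos_right _ (by positivity)) hb2
      obtain ⟨p, hp, hp0, rs', hrs', hk⟩ := step_good hb1 (elim pr) rs [] hrs (by simp) he
      have hs := ih _ (sh Λ) rs' hb2 hrs' hv' hk
      refine fin ?_ hs
      obtain ⟨f, rfl, _, hf⟩ := hp
      rw [eval_mod] at hp0
      rw [← Polynomial.X_mul_divX_add f, map_add, LC, ← sh_apply, hs, zero_add] at hf
      rcases mul_eq_zero.1 hf with h | h
      · rw [ZMod.natCast_eq_zero_iff] at h; omega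
      · exact h

end Elim

section Rows
open Polynomial

def kEP (u : V3) : Polynomial ℕ := Polynomial.C u.a + (Polynomial.C u.b * Polynomial.X + Polynomial.C u.c * Polynomial.X ^ 9)
def kTP (u v w : V3) : Polynomial ℕ := (kEP u * (kEP v * kEP w)) ^ 2
def yv (du : Bool) (r mu : ℕ) (e : ℕ × ℕ × ℕ) (j : ℕ) : ℕ :=
  (0 :: 0 :: tl du r mu (mv e.1) (mv e.2.1) (mv e.2.2)).getD j 0
def kTe (e : ℕ × ℕ × ℕ) : Polynomial ℕ := kTP (mv e.1) (mv e.2.1) (mv e.2.2)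
def gP (du : Bool) (r mu : ℕ) (l : List (ℕ × ℕ × ℕ)) (j : ℕ) : Polynomial ℕ :=
  (l.map fun e => Polynomial.C (yv du r mu e j) * kTe e).sum
def rP (du : Bool) (r mu rho : ℕ) (T : List (ℕ × List (ℕ × ℕ × ℕ))) (j : ℕ) : Polynomial ℕ :=
  (T.map fun t => Polynomial.C (t.1 ^ rho % 11) * gP du r mu t.2 j).sum
def uP (mu : ℕ) : Polynomial ℕ := Polynomial.X + Polynomial.C mu * Polynomial.X ^ 9
def fP (du : Bool) (r mu rho s : ℕ) : Polynomial ℕ :=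
  rP du r mu rho tab (s+2) + (2 * uP mu * rP du r mu rho tab (s+1)
    + uP mu * uP mu * rP du r mu rho tab s)

lemma kE_eval (u : V3) : (kEP u).eval BB = kE u := by
  simp only [kEP, kE, BB9, Polynomial.eval_add, Polynomial.eval_mul, Polynomial.eval_C, Polynomial.eval_X, Polynomial.eval_pow]; rfl
lemma kT_eval (u v w : V3) : (kTP u v w).eval BB = kT u v w := by
  simp only [kTP, kT, Polynomial.eval_mul, Polynomial.eval_pow, kE_eval]; rfl

lemma axpy_spec (c : ℕ) (ys : List ℕ) : ∀ acc : List ℕ, ys.length = acc.length →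
    (axpy c ys acc).length = acc.length ∧
    ∀ s, (axpy c ys acc).getD s 0 = acc.getD s 0 + c * ys.getD s 0 := by
  induction ys with
  | nil =>
    intro acc h
    have : acc = [] := List.length_eq_zero_iff.1 h.symm
    subst this
    exact ⟨rfl, fun s => by simp [axpy]⟩
  | cons y ys ih =>
    intro acc h
    cases acc with
    | nil => simp at h
    | cons a as =>
      have e : axpy c (y :: ys) (a :: as) = (a + c * y) :: axpy c ys as := rfl
      obtain ⟨h1, h2⟩ := ih as (by simpa using h)
      rw [e]
      refine ⟨by simp [h1], ?_⟩
      intro s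
      cases s with
      | zero => simp
      | succ s => simpa using h2 s

lemma yl_len (r a1 a2 a3 k : ℕ) : ∀ s y1 y2 y3, (yl r a1 a2 a3 k s y1 y2 y3).length = k := by
  induction k with
  | zero => intros; rfl
  | succ k ih =>
    intro s y1 y2 y3
    have e : yl r a1 a2 a3 (k+1) s y1 y2 y3 = ystep r a1 a2 a3 s y1 y2 y3 ::
      yl r a1 a2 a3 k (s+1) (ystep r a1 a2 a3 s y1 y2 y3) y1 y2 := rfl
    rw [e]; simp [ih]

lemma dl_eq (r a1 a2 a3 k s y1 y2 y3 d1 d2 d3 : ℕ) :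
    dl r a1 a2 a3 (k+1) s y1 y2 y3 d1 d2 d3 = dstep r a1 a2 a3 s y1 y2 y3 d1 d2 d3 ::
      dl r a1 a2 a3 k (s+1) (ystep r a1 a2 a3 s y1 y2 y3) y1 y2
        (dstep r a1 a2 a3 s y1 y2 y3 d1 d2 d3) d1 d2 := rfl
lemma yl_eq (r a1 a2 a3 k s y1 y2 y3 : ℕ) :
    yl r a1 a2 a3 (k+1) s y1 y2 y3 = ystep r a1 a2 a3 s y1 y2 y3 ::
      yl r a1 a2 a3 k (s+1) (ystep r a1 a2 a3 s y1 y2 y3) y1 y2 := rfl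

lemma dl_len (r a1 a2 a3 k : ℕ) : ∀ s y1 y2 y3 d1 d2 d3,
    (dl r a1 a2 a3 k s y1 y2 y3 d1 d2 d3).length = k := by
  induction k with
  | zero => intros; rfl
  | succ k ih => intros; rw [dl_eq]; simp [ih]

lemma ystep_lt (r a1 a2 a3 s y1 y2 y3 : ℕ) : ystep r a1 a2 a3 s y1 y2 y3 < 11 :=
  Nat.mod_lt _ (by norm_num)
lemma dstep_lt (r a1 a2 a3 s y1 y2 y3 d1 d2 d3 : ℕ) : dstep r a1 a2 a3 s y1 y2 y3 d1 d2 d3 < 11 :=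
  Nat.mod_lt _ (by norm_num)

lemma yl_lt (r a1 a2 a3 k : ℕ) : ∀ s y1 y2 y3, ∀ x ∈ yl r a1 a2 a3 k s y1 y2 y3, x < 11 := by
  induction k with
  | zero => intro s y1 y2 y3 x hx; exact absurd hx (by simp [yl])
  | succ k ih =>
    intro s y1 y2 y3 x hx
    rw [yl_eq] at hx
    rcases List.mem_cons.1 hx with rfl | hx
    · exact ystep_lt ..
    · exact ih _ _ _ _ x hx

lemma dl_lt (r a1 a2 a3 k : ℕ) : ∀ s y1 y2 y3 d1 d2 d3,
    ∀ x ∈ dl r a1 a2 a3 k s y1 y2 y3 d1 d2 d3, x < 11 := by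
  induction k with
  | zero => intro s y1 y2 y3 d1 d2 d3 x hx; exact absurd hx (by simp [dl])
  | succ k ih =>
    intro s y1 y2 y3 d1 d2 d3 x hx
    rw [dl_eq] at hx
    rcases List.mem_cons.1 hx with rfl | hx
    · exact dstep_lt ..
    · exact ih _ _ _ _ _ _ _ x hx

lemma yl_rec (r a1 a2 a3 k : ℕ) : ∀ s y1 y2 y3 j, j < k →
    (y3 :: y2 :: y1 :: yl r a1 a2 a3 k s y1 y2 y3).getD (j+3) 0
     = ystep r a1 a2 a3 (s+j)
       ((y3 :: y2 :: y1 :: yl r a1 a2 a3 k s y1 y2 y3).getD (j+2) 0)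
       ((y3 :: y2 :: y1 :: yl r a1 a2 a3 k s y1 y2 y3).getD (j+1) 0)
       ((y3 :: y2 :: y1 :: yl r a1 a2 a3 k s y1 y2 y3).getD j 0) := by
  induction k with
  | zero => intros; omega
  | succ k ih =>
    intro s y1 y2 y3 j hj
    rw [yl_eq]
    cases j with
    | zero => rfl
    | succ j =>
      have := ih (s+1) (ystep r a1 a2 a3 s y1 y2 y3) y1 y2 j (by omega)
      rw [show s + (j+1) = s + 1 + j by ring]
      exact this

lemma dl_rec (r a1 a2 a3 k : ℕ) : ∀ s y1 y2 y3 d1 d2 d3 j, j < k →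
    (d3 :: d2 :: d1 :: dl r a1 a2 a3 k s y1 y2 y3 d1 d2 d3).getD (j+3) 0
     = dstep r a1 a2 a3 (s+j)
       ((y3 :: y2 :: y1 :: yl r a1 a2 a3 k s y1 y2 y3).getD (j+2) 0)
       ((y3 :: y2 :: y1 :: yl r a1 a2 a3 k s y1 y2 y3).getD (j+1) 0)
       ((y3 :: y2 :: y1 :: yl r a1 a2 a3 k s y1 y2 y3).getD j 0)
       ((d3 :: d2 :: d1 :: dl r a1 a2 a3 k s y1 y2 y3 d1 d2 d3).getD (j+2) 0)
       ((d3 :: d2 :: d1 :: dl r a1 a2 a3 k s y1 y2 y3 d1 d2 d3).getD (j+1) 0)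
       ((d3 :: d2 :: d1 :: dl r a1 a2 a3 k s y1 y2 y3 d1 d2 d3).getD j 0) := by
  induction k with
  | zero => intros; omega
  | succ k ih =>
    intro s y1 y2 y3 d1 d2 d3 j hj
    rw [yl_eq, dl_eq]
    cases j with
    | zero => rfl
    | succ j =>
      have := ih (s+1) (ystep r a1 a2 a3 s y1 y2 y3) y1 y2 (dstep r a1 a2 a3 s y1 y2 y3 d1 d2 d3) d1 d2 j
        (by omega)
      rw [show s + (j+1) = s + 1 + j by ring]
      exact this

def q11 (mu : ℕ) (u v : V3) : ℕ := m11 (dB mu u v * inv11 (dA u v))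
def e1 (mu : ℕ) (u v w : V3) : ℕ := m11 (q11 mu u v + (q11 mu u w + q11 mu v w))
def e2 (mu : ℕ) (u v w : V3) : ℕ :=
  m11 (q11 mu u v * q11 mu u w + (q11 mu u v * q11 mu v w + q11 mu u w * q11 mu v w))
def e3 (mu : ℕ) (u v w : V3) : ℕ := m11 (q11 mu u v * (q11 mu u w * q11 mu v w))

lemma tl_false (r mu : ℕ) (u v w : V3) : tl false r mu u v w =
    1 :: yl r (e1 mu u v w) (e2 mu u v w) (e3 mu u v w) 10 1 1 0 0 := rfl
lemma tl_true (r mu : ℕ) (u v w : V3) : tl true r mu u v w =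
    0 :: dl r (e1 mu u v w) (e2 mu u v w) (e3 mu u v w) 10 1 1 0 0 0 0 0 := rfl

lemma tl_len (du : Bool) (r mu : ℕ) (u v w : V3) : (tl du r mu u v w).length = 11 := by
  cases du
  · rw [tl_false]; simp [yl_len]
  · rw [tl_true]; simp [dl_len]

lemma yv_lt (du : Bool) (r mu : ℕ) (e) (j : ℕ) : yv du r mu e j < 11 := by
  have h : ∀ x ∈ (0 :: 0 :: tl du r mu (mv e.1) (mv e.2.1) (mv e.2.2)), x < 11 := by
    intro x hx
    simp only [List.mem_cons] at hx
    rcases hx with rfl | rfl | hx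
    · norm_num
    · norm_num
    · cases du
      · rw [tl_false] at hx
        rcases List.mem_cons.1 hx with rfl | hx
        · norm_num
        · exact yl_lt _ _ _ _ _ _ _ _ _ x hx
      · rw [tl_true] at hx
        rcases List.mem_cons.1 hx with rfl | hx
        · norm_num
        · exact dl_lt _ _ _ _ _ _ _ _ _ _ _ _ x hx
  unfold yv
  rw [List.getD_eq_getElem?_getD]
  rcases lt_or_ge j (0 :: 0 :: tl du r mu (mv e.1) (mv e.2.1) (mv e.2.2)).length with hj | hj
  · rw [List.getElem?_eq_getElem hj]
    exact h _ (List.getElem_mem hj)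
  · rw [List.getElem?_eq_none hj]; norm_num

/-- spec of the recursion -/
lemma yv_rec (r mu : ℕ) (e) (j : ℕ) (hj : j < 10) :
    yv false r mu e (j+3) = ystep r (e1 mu (mv e.1) (mv e.2.1) (mv e.2.2))
      (e2 mu (mv e.1) (mv e.2.1) (mv e.2.2)) (e3 mu (mv e.1) (mv e.2.1) (mv e.2.2)) (1+j)
      (yv false r mu e (j+2)) (yv false r mu e (j+1)) (yv false r mu e j) := by
  unfold yv
  rw [tl_false]
  exact yl_rec _ _ _ _ 10 1 1 0 0 j hj

lemma dv_rec (r mu : ℕ) (e) (j : ℕ) (hj : j < 10) :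
    yv true r mu e (j+3) = dstep r (e1 mu (mv e.1) (mv e.2.1) (mv e.2.2))
      (e2 mu (mv e.1) (mv e.2.1) (mv e.2.2)) (e3 mu (mv e.1) (mv e.2.1) (mv e.2.2)) (1+j)
      (yv false r mu e (j+2)) (yv false r mu e (j+1)) (yv false r mu e j)
      (yv true r mu e (j+2)) (yv true r mu e (j+1)) (yv true r mu e j) := by
  unfold yv
  rw [tl_false, tl_true]
  exact dl_rec _ _ _ _ 10 1 1 0 0 0 0 0 j hj

lemma gtab_spec (du : Bool) (r mu : ℕ) (l : List (ℕ × ℕ × ℕ)) :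
    (gtab du r mu l).length = 11 ∧
    ∀ j, (0 :: 0 :: gtab du r mu l).getD j 0 = (gP du r mu l j).eval BB := by
  induction l with
  | nil =>
    refine ⟨rfl, fun j => ?_⟩
    have : gtab du r mu [] = z11 := rfl
    rw [this]
    simp only [gP, List.map_nil, List.sum_nil, Polynomial.eval_zero]
    have : (0 :: 0 :: z11) = List.replicate 13 0 := rfl
    rw [this, List.getD_eq_getElem?_getD, List.getElem?_replicate]
    split_ifs <;> rfl
  | cons e l ih =>
    have he : gtab du r mu (e :: l) = axpy (kT (mv e.1) (mv e.2.1) (mv e.2.2))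
      (tl du r mu (mv e.1) (mv e.2.1) (mv e.2.2)) (gtab du r mu l) := rfl
    obtain ⟨h1, h2⟩ := axpy_spec (kT (mv e.1) (mv e.2.1) (mv e.2.2))
      (tl du r mu (mv e.1) (mv e.2.1) (mv e.2.2)) (gtab du r mu l) (by rw [tl_len, ih.1])
    rw [he]
    refine ⟨by rw [h1, ih.1], fun j => ?_⟩
    have hs : (gP du r mu (e :: l) j).eval BB
      = yv du r mu e j * kT (mv e.1) (mv e.2.1) (mv e.2.2) + (gP du r mu l j).eval BB := by
      simp [gP, kTe, kT_eval]
    rw [hs, ← ih.2 j]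
    match j with
    | 0 => simp [yv]
    | 1 => simp [yv]
    | j+2 => simp only [yv, List.getD_cons_succ]; rw [h2]; ring

lemma Rl_spec (du : Bool) (r mu rho : ℕ) (T : List (ℕ × List (ℕ × ℕ × ℕ))) :
    (Rl du r mu rho T).length = 11 ∧
    ∀ j, (0 :: 0 :: Rl du r mu rho T).getD j 0 = (rP du r mu rho T j).eval BB := by
  induction T with
  | nil =>
    refine ⟨rfl, fun j => ?_⟩
    have : Rl du r mu rho [] = z11 := rfl
    rw [this]
    simp only [rP, List.map_nil, List.sum_nil, Polynomial.eval_zero]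
    have : (0 :: 0 :: z11) = List.replicate 13 0 := rfl
    rw [this, List.getD_eq_getElem?_getD, List.getElem?_replicate]
    split_ifs <;> rfl
  | cons e l ih =>
    have he : Rl du r mu rho (e :: l) = axpy (e.1 ^ rho % 11) (gtab du r mu e.2) (Rl du r mu rho l) := rfl
    obtain ⟨h1, h2⟩ := axpy_spec (e.1 ^ rho % 11) (gtab du r mu e.2) (Rl du r mu rho l)
      (by rw [(gtab_spec du r mu e.2).1, ih.1])
    rw [he]
    refine ⟨by rw [h1, ih.1], fun j => ?_⟩
    have hs : (rP du r mu rho (e :: l) j).eval BB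
      = e.1 ^ rho % 11 * (gP du r mu e.2 j).eval BB + (rP du r mu rho l j).eval BB := by
      simp only [rP, List.map_cons, List.sum_cons, Polynomial.eval_add, Polynomial.eval_mul, Polynomial.eval_C]
    rw [hs, ← ih.2 j, ← (gtab_spec du r mu e.2).2 j]
    match j with
    | 0 => simp
    | 1 => simp
    | j+2 => simp only [List.getD_cons_succ]; rw [h2]; ring

lemma conv_spec (U U2 : ℕ) (l : List ℕ) : ∀ x1 x2, (conv U U2 l x1 x2).length = l.length ∧
    ∀ s, s < l.length → (conv U U2 l x1 x2).getD s 0 = (x2 :: x1 :: l).getD (s+2) 0 +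
      (U2 * (x2 :: x1 :: l).getD (s+1) 0 + U * U * (x2 :: x1 :: l).getD s 0) := by
  induction l with
  | nil => intro x1 x2; exact ⟨rfl, fun s hs => absurd hs (by simp)⟩
  | cons x l ih =>
    intro x1 x2
    have e : conv U U2 (x :: l) x1 x2 = (x + (U2 * x1 + U * U * x2)) :: conv U U2 l x x1 := rfl
    rw [e]
    obtain ⟨h1, h2⟩ := ih x x1
    refine ⟨by simp [h1], ?_⟩
    intro s hs
    cases s with
    | zero => rfl
    | succ s => exact h2 s (by simpa using hs)

lemma uP_eval (mu : ℕ) : (uP mu).eval BB = uu mu := by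
  simp only [uP, uu, BB9, Polynomial.eval_add, Polynomial.eval_mul, Polynomial.eval_C, Polynomial.eval_X, Polynomial.eval_pow]; rfl

lemma rowsMu_spec (du : Bool) (r rho mu : ℕ) : (rowsMu du r rho mu).length = 11 ∧
    ∀ s, s < 11 → (rowsMu du r rho mu).getD s 0 = (fP du r mu rho s).eval BB := by
  obtain ⟨h1, h2⟩ := conv_spec (uu mu) (Nat.mul 2 (uu mu)) (Rl du r mu rho tab) 0 0
  obtain ⟨h3, h4⟩ := Rl_spec du r mu rho tab
  refine ⟨by rw [rowsMu, h1, h3], fun s hs => ?_⟩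
  rw [rowsMu, h2 s (by omega), h4, h4, h4, fP]
  simp only [Polynomial.eval_add, Polynomial.eval_mul, uP_eval]
  simp

lemma mem_rows {r rho mu x : ℕ} (h : x ∈ selRows r rho mu) :
    ∃ du s, s < 11 ∧ (du = true → 3*r+3 ≤ s) ∧ x = (fP du r mu rho s).eval BB := by
  unfold selRows at h
  have h := List.mem_of_mem_drop h
  have key : ∀ du s, (hs : s < (rowsMu du r rho mu).length) → 
      (rowsMu du r rho mu)[s] = (fP du r mu rho s).eval BB := by
    intro du s hs
    have := (rowsMu_spec du r rho mu).2 s (by rwa [(rowsMu_spec du r rho mu).1] at hs)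
    rw [← this, List.getD_eq_getElem _ _ hs]
  rcases List.mem_append.1 h with h | h
  · obtain ⟨s, hs, rfl⟩ := List.mem_iff_getElem.1 (List.mem_of_mem_take h)
    exact ⟨false, s, by rwa [(rowsMu_spec false r rho mu).1] at hs, by simp, key _ _ _⟩
  · cases hb : Nat.ble 3 r with
    | true => rw [hb] at h; exact absurd h (by simp)
    | false =>
      rw [hb] at h
      obtain ⟨s, hs, rfl⟩ := List.mem_iff_getElem.1 h
      have hs' := hs
      rw [List.length_drop, (rowsMu_spec true r rho mu).1] at hs'
      refine ⟨true, 3*r+3+s, by omega, by intro; omega, ?_⟩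
      exact (List.getElem_drop ..).trans (key _ _ _)

lemma mem_allRows {r rho x : ℕ} (h : x ∈ allRows r rho) :
    ∃ du mu s, mu < 6 ∧ s < 11 ∧ (du = true → 3*r+3 ≤ s) ∧ x = (fP du r mu rho s).eval BB := by
  unfold allRows at h
  simp only [List.mem_append] at h
  rcases h with h | h | h | h | h | h
  all_goals
    obtain ⟨du, s, h1, h2, h3⟩ := mem_rows h
    exact ⟨du, _, s, by norm_num, h1, h2, h3⟩

lemma mv_le : ∀ i, (mv i).a ≤ 10 ∧ (mv i).b ≤ 10 ∧ (mv i).c ≤ 10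
  | 0 => by decide
  | 1 => by decide
  | 2 => by decide
  | 3 => by decide
  | 4 => by decide
  | 5 => by decide
  | 6 => by decide
  | 7 => by decide
  | (n+8) => by
    have : mv (n+8) = ⟨1,4,6⟩ := rfl
    rw [this]; decide

lemma kE1 (i : ℕ) : (kEP (mv i)).eval 1 ≤ 30 := by
  obtain ⟨h1, h2, h3⟩ := mv_le i
  simp [kEP]; omega

lemma kTe1 (e) : (kTe e).eval 1 ≤ 30 ^ 6 := by
  simp only [kTe, kTP, Polynomial.eval_pow, Polynomial.eval_mul]
  calc _ ≤ (30 * (30 * 30)) ^ 2 := by gcongr <;> exact kE1 _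
    _ = 30 ^ 6 := by norm_num

lemma sum_le_len {α : Type*} (l : List α) (f : α → Polynomial ℕ) (c : ℕ)
    (h : ∀ x ∈ l, (f x).eval 1 ≤ c) : ((l.map f).sum).eval 1 ≤ l.length * c := by
  induction l with
  | nil => simp
  | cons a l ih =>
    simp only [List.map_cons, List.sum_cons, Polynomial.eval_add, List.length_cons]
    have := ih (fun x hx => h x (by simp [hx]))
    have := h a (by simp)
    linarith

lemma gP1 (du r mu l j) : (gP du r mu l j).eval 1 ≤ l.length * (10 * 30 ^ 6) := by
  apply sum_le_len
  intro e _
  simp only [Polynomial.eval_mul, Polynomial.eval_C]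
  have := yv_lt du r mu e j
  exact Nat.mul_le_mul (by omega) (kTe1 e)

lemma tab_len : ∀ t ∈ tab, t.2.length ≤ 12 := by decide

lemma rP1 (du r mu rho j) : (rP du r mu rho tab j).eval 1 ≤ 10 * (10 * (12 * (10 * 30 ^ 6))) := by
  refine le_trans (sum_le_len tab _ (10 * (12 * (10 * 30 ^ 6))) ?_) (le_of_eq rfl)
  intro t ht
  simp only [Polynomial.eval_mul, Polynomial.eval_C]
  refine Nat.mul_le_mul (by omega) ((gP1 _ _ _ _ _).trans ?_)
  exact Nat.mul_le_mul_right _ (tab_len t ht)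

lemma fP1 (du r mu rho s) (hmu : mu < 6) : (fP du r mu rho s).eval 1 ≤ 49 * (10 * (10 * (12 * (10 * 30 ^ 6)))) := by
  simp only [fP, Polynomial.eval_add, Polynomial.eval_mul]
  have hu : (uP mu).eval 1 ≤ 6 := by simp [uP]; omega
  have h2 : (2 : Polynomial ℕ).eval 1 = 2 := by simp
  rw [h2]
  calc _ ≤ 10 * (10 * (12 * (10 * 30 ^ 6))) + (2 * 6 * (10 * (10 * (12 * (10 * 30 ^ 6)))) + 6 * 6 * (10 * (10 * (12 * (10 * 30 ^ 6))))) := by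
        gcongr <;> apply rP1
    _ = _ := by norm_num

lemma final_mod (r rho : ℕ) (hc : chk r rho = true) (Λ : LL)
    (hv : ∀ i, 9 ≤ i % 9 + i / 9 → Λ (Polynomial.X ^ i) = 0)
    (hrow : ∀ du mu s, mu < 6 → s < 11 → (du = true → 3*r+3 ≤ s) → Λ (fP du r mu rho s) = 0) :
    ∀ f, Λ f = 0 := by
  refine elim_sound prog (49 * (10 * (10 * (12 * (10 * 30 ^ 6))))) Λ (allRows r rho) (by decide +kernel) ?_ ?_ hc
  · intro x hx
    obtain ⟨du, mu, s, h1, h2, h3, rfl⟩ := mem_allRows hx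
    exact ⟨_, rfl, fP1 _ _ _ _ _ h1, hrow du mu s h1 h2 h3⟩
  · intro i hi
    apply hv
    by_cases h : i < 73
    · revert hi; revert i; decide
    · omega

end Rows

section LemB

/-- padded coefficients -/
def cp {R : Type*} [Semiring R] (H : Polynomial R) (j : ℕ) : R := if j < 2 then 0 else H.coeff (j-2)

lemma cp_add2 {R : Type*} [Semiring R] (H : Polynomial R) (j : ℕ) : cp H (j+2) = H.coeff j := by
  simp [cp]
lemma cp_0 {R : Type*} [Semiring R] (H : Polynomial R) : cp H 0 = 0 := by simp [cp]
lemma cp_1 {R : Type*} [Semiring R] (H : Polynomial R) : cp H 1 = 0 := by simp [cp]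

def cub {R : Type*} [CommRing R] (p0 p1 p2 p3 : R) : Polynomial R :=
  Polynomial.C p0 + Polynomial.C p1 * Polynomial.X + Polynomial.C p2 * Polynomial.X ^ 2
    + Polynomial.C p3 * Polynomial.X ^ 3

lemma cub_map {R S : Type*} [CommRing R] [CommRing S] (f : R →+* S) (p0 p1 p2 p3 : R) :
    (cub p0 p1 p2 p3).map f = cub (f p0) (f p1) (f p2) (f p3) := by
  simp [cub]

lemma cub_coeff0 {R : Type*} [CommRing R] (p0 p1 p2 p3 : R) : (cub p0 p1 p2 p3).coeff 0 = p0 := by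
  simp [cub]

lemma cub_der {R : Type*} [CommRing R] (p0 p1 p2 p3 : R) :
    Polynomial.derivative (cub p0 p1 p2 p3) = cub p1 (2*p2) (3*p3) 0 := by
  have h2 : (Polynomial.C (2 : R)) = 2 := rfl
  have h3 : (Polynomial.C (3 : R)) = 3 := rfl
  simp [cub, h2, h3]; ring

lemma cub_coeff {R : Type*} [CommRing R] (p0 p1 p2 p3 : R) (H : Polynomial R) (s : ℕ) :
    (cub p0 p1 p2 p3 * Polynomial.derivative H).coeff s =
      p0 * (s+1) * cp H (s+3) + p1 * s * cp H (s+2) + p2 * (s-1) * cp H (s+1) + p3 * (s-2) * cp H s := by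
  simp only [cub, add_mul, Polynomial.coeff_add, mul_assoc, Polynomial.coeff_C_mul,
    Polynomial.coeff_X_pow_mul', cp]
  match s with
  | 0 => simp [Polynomial.coeff_derivative]
  | 1 => simp [Polynomial.coeff_derivative, Polynomial.coeff_X_mul]; ring
  | 2 => simp [Polynomial.coeff_derivative, Polynomial.coeff_X_mul]; ring
  | s+3 =>
    simp only [Polynomial.coeff_X_mul, Polynomial.coeff_derivative]
    simp [show s + 3 - 2 = s + 1 by omega, show s + 3 + 1 - 2 = s + 2 by omega]
    ring

lemma cub_coeff' {R : Type*} [CommRing R] (p0 p1 p2 p3 : R) (H : Polynomial R) (s : ℕ) :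
    (Polynomial.derivative (cub p0 p1 p2 p3) * H).coeff s =
      p1 * cp H (s+2) + 2 * p2 * cp H (s+1) + 3 * p3 * cp H s := by
  rw [cub_der]
  simp only [cub, add_mul, Polynomial.coeff_add, mul_assoc, Polynomial.coeff_C_mul,
    Polynomial.coeff_X_pow_mul', cp]
  match s with
  | 0 => simp
  | 1 => simp [Polynomial.coeff_X_mul]
  | s+2 => simp [Polynomial.coeff_X_mul]

lemma pow_der {R : Type*} [CommRing R] (P : Polynomial R) (n : ℕ) :
    P * Polynomial.derivative (P ^ n) = Polynomial.C (n : R) * (Polynomial.derivative P * P ^ n) := by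
  rw [Polynomial.derivative_pow]
  cases n with
  | zero => simp
  | succ n => simp; ring

lemma f11_ne (s : ℕ) (hs : s < 10) : ((s : ZMod 11) + 1) ≠ 0 := by
  interval_cases s <;> decide

lemma f11_inv (x : ZMod 11) (h : x ≠ 0) : x ^ 9 * x = 1 := by
  revert x; decide +kernel

lemma uniq11 (r p0 p1 p2 p3 a1 a2 a3 c : ZMod 11) (h0 : p0 ≠ 0) (h1 : a1 * p0 = p1)
    (h2 : a2 * p0 = p2) (h3 : a3 * p0 = p3) (y h k : ℕ → ZMod 11)
    (y0 : h 0 = c * y 0) (y1 : h 1 = c * y 1) (y2 : h 2 = c * y 2)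
    (hy : ∀ s, s < 10 → y (s+3) = (s+1) ^ 9 * (a1 * (r - s) * y (s+2) + a2 * (2*r+1-s) * y (s+1)
      + a3 * (3*r+2-s) * y s + k s))
    (hh : ∀ s, s < 10 → p0 * (s+1) * h (s+3) = p1 * (r - s) * h (s+2) + p2 * (2*r+1-s) * h (s+1)
      + p3 * (3*r+2-s) * h s + p0 * c * k s) :
    ∀ j, j ≤ 12 → h j = c * y j := by
  intro j
  induction j using Nat.strong_induction_on with
  | _ j ih =>
    intro hj
    match j with
    | 0 => exact y0
    | 1 => exact y1
    | 2 => exact y2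
    | s+3 =>
      have e1 := hh s (by omega)
      have e2 := hy s (by omega)
      rw [ih (s+2) (by omega) (by omega), ih (s+1) (by omega) (by omega),
        ih s (by omega) (by omega)] at e1
      have n1 := f11_ne s (by omega)
      have i1 := f11_inv _ n1
      apply mul_left_cancel₀ (mul_ne_zero h0 n1)
      rw [e1, e2]
      subst h1 h2 h3
      linear_combination (-(c * p0 * (a1 * (r - s) * y (s+2) + a2 * (2*r+1-s) * y (s+1)
      + a3 * (3*r+2-s) * y s + k s))) * i1

/-- integer polynomial Q -/
def Qp (P : Polynomial ℤ) (N : ℕ) : Polynomial ℤ :=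
  ∑ j ∈ Finset.range 10, Polynomial.C ((3628800 / ((j : ℤ)+1)) *
    (Polynomial.derivative P * P ^ (N-1)).coeff j) * Polynomial.X ^ (j+1)

lemma Qp_coeff (P : Polynomial ℤ) (N i : ℕ) (hi : i < 10) :
    (Qp P N).coeff (i+1) = (3628800 / ((i : ℤ)+1)) * (Polynomial.derivative P * P ^ (N-1)).coeff i := by
  simp only [Qp, Polynomial.finsetSum_coeff, Polynomial.coeff_C_mul, Polynomial.coeff_X_pow]
  rw [Finset.sum_eq_single i]
  · simp
  · intro b _ hb
    rw [if_neg (by omega), mul_zero]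
  · intro h; exact absurd (Finset.mem_range.2 hi) h

lemma Qp_coeff0 (P : Polynomial ℤ) (N : ℕ) : (Qp P N).coeff 0 = 0 := by
  simp [Qp]

lemma fac_div (i : ℕ) (hi : i < 10) : (3628800 / ((i : ℤ)+1)) * (i + 1) = 3628800 := by
  interval_cases i <;> norm_num

lemma Qp_der (P : Polynomial ℤ) (N : ℕ) : (Polynomial.X ^ 10 : Polynomial ℤ) ∣
    Polynomial.derivative (Qp P N) - Polynomial.C 3628800 * (Polynomial.derivative P * P ^ (N-1)) := by
  rw [Polynomial.X_pow_dvd_iff]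
  intro d hd
  rw [Polynomial.coeff_sub, Polynomial.coeff_derivative, Qp_coeff _ _ _ hd, Polynomial.coeff_C_mul]
  linear_combination (Polynomial.derivative P * P ^ (N-1)).coeff d * fac_div d hd

lemma Qp_pow (P : Polynomial ℤ) (N : ℕ) : (Polynomial.X ^ 11 : Polynomial ℤ) ∣
    Polynomial.C 3628800 * P ^ N - Polynomial.C (3628800 * P.coeff 0 ^ N) - Polynomial.C (N : ℤ) * Qp P N := by
  rw [Polynomial.X_pow_dvd_iff]
  intro d hd
  cases d with
  | zero => 
    have := Qp_coeff0 P N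
    rw [Polynomial.coeff_zero_eq_eval_zero] at this
    simp [this, Polynomial.coeff_zero_eq_eval_zero]
  | succ d =>
    have e : (Polynomial.derivative (P ^ N)).coeff d = N * (Polynomial.derivative P * P ^ (N-1)).coeff d := by
      rw [Polynomial.derivative_pow, mul_assoc, Polynomial.coeff_C_mul, mul_comm (Polynomial.derivative P)]
    rw [Polynomial.coeff_derivative] at e
    simp only [Polynomial.coeff_sub, Polynomial.coeff_C_mul, Polynomial.coeff_C_succ]
    rw [Qp_coeff _ _ _ (by omega)]
    linear_combination (3628800 / ((d : ℤ)+1)) * e - (P ^ N).coeff (d+1) * fac_div d (by omega)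

/-- integer coefficients -/
def Em (P : Polynomial ℤ) (n : ℕ) (du : Bool) (j : ℕ) : ℤ :=
  if du then cp (-(P ^ (n % 11) * Qp P (n - n % 11))) j else cp (P ^ n) j

lemma cub_natDegree (p0 p1 p2 p3 : ℤ) : (cub p0 p1 p2 p3).natDegree ≤ 3 := by
  unfold cub; compute_degree

lemma Em_true (p0 p1 p2 p3 : ℤ) (n s : ℕ) (hs : s < 11) (hs' : 3 * (n % 11) < s) :
    3628800 * Em (cub p0 p1 p2 p3) n false (s+2)
      = -((n - n % 11 : ℕ) : ℤ) * Em (cub p0 p1 p2 p3) n true (s+2) := by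
  set P := cub p0 p1 p2 p3
  set r := n % 11 with hr
  set N := n - r with hN
  have h := dvd_mul_of_dvd_right (Qp_pow P N) (P ^ r)
  rw [Polynomial.X_pow_dvd_iff] at h
  have h := h s hs
  have e : P ^ r * (Polynomial.C 3628800 * P ^ N - Polynomial.C (3628800 * P.coeff 0 ^ N) - Polynomial.C (N : ℤ) * Qp P N)
    = Polynomial.C 3628800 * P ^ n - Polynomial.C (3628800 * P.coeff 0 ^ N) * P ^ r - Polynomial.C (N : ℤ) * (P ^ r * Qp P N) := by
    have : P ^ n = P ^ r * P ^ N := by rw [← pow_add]; congr 1; omega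
    rw [this]; ring
  rw [e, Polynomial.coeff_sub, Polynomial.coeff_sub, Polynomial.coeff_C_mul, Polynomial.coeff_C_mul,
    Polynomial.coeff_C_mul] at h
  have hd : (P ^ r).coeff s = 0 := by
    apply Polynomial.coeff_eq_zero_of_natDegree_lt
    calc _ ≤ r * P.natDegree := Polynomial.natDegree_pow_le
      _ ≤ r * 3 := by gcongr; exact cub_natDegree ..
      _ < s := by omega
  rw [hd] at h
  simp only [Em, if_true, Bool.false_eq_true, if_false, cp_add2, Polynomial.coeff_neg]
  rw [← hr, ← hN]
  linarith

lemma cp_map {R S : Type*} [CommRing R] [CommRing S] (f : R →+* S) (H : Polynomial R) (j : ℕ) :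
    cp (H.map f) j = f (cp H j) := by
  unfold cp; split_ifs <;> simp

lemma X_dvd_cub {R : Type*} [CommRing R] (p1 p2 p3 : R) : (Polynomial.X : Polynomial R) ∣ cub 0 p1 p2 p3 := by
  rw [Polynomial.X_dvd_iff]; simp [cub]

lemma cp_dvd {R : Type*} [CommRing R] (H : Polynomial R) (m : ℕ) (h : Polynomial.X ^ m ∣ H) (j : ℕ)
    (hj : j < m + 2) : cp H j = 0 := by
  unfold cp
  split_ifs with hh
  · rfl
  · exact Polynomial.X_pow_dvd_iff.1 h _ (by omega)

lemma fac11 : (3628800 : ZMod 11) = -1 := by decide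

lemma LemB_false (p0 p1 p2 p3 : ℤ) (a1 a2 a3 : ZMod 11) (h1 : (p0 : ZMod 11) ≠ 0 → a1 * p0 = p1)
    (h2 : (p0 : ZMod 11) ≠ 0 → a2 * p0 = p2) (h3 : (p0 : ZMod 11) ≠ 0 → a3 * p0 = p3) (n : ℕ) (hn : 21 ≤ n)
    (y : ℕ → ZMod 11) (y0 : y 0 = 0) (y1 : y 1 = 0) (y2 : y 2 = 1)
    (hy : ∀ s, s < 10 → y (s+3) = (s+1) ^ 9 * (a1 * (n - s) * y (s+2) + a2 * (2*n+1-s) * y (s+1)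
      + a3 * (3*n+2-s) * y s)) (j : ℕ) (hj : j ≤ 12) :
    ((Em (cub p0 p1 p2 p3) n false j : ℤ) : ZMod 11) = p0 ^ n * y j := by
  have e0 : ((Em (cub p0 p1 p2 p3) n false j : ℤ) : ZMod 11)
    = cp ((cub (p0 : ZMod 11) p1 p2 p3) ^ n) j := by
    have := cp_map (Int.castRingHom (ZMod 11)) ((cub p0 p1 p2 p3) ^ n) j
    rw [Polynomial.map_pow, cub_map] at this
    simpa [Em] using this.symm
  rw [e0]
  by_cases hp : (p0 : ZMod 11) = 0
  · rw [hp, zero_pow (by omega), zero_mul]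
    exact cp_dvd _ n (pow_dvd_pow_of_dvd (X_dvd_cub _ _ _) n) j (by omega)
  · refine uniq11 n p0 p1 p2 p3 a1 a2 a3 (p0 ^ n) hp (h1 hp) (h2 hp) (h3 hp) y _ 0 ?_ ?_ ?_ ?_ ?_ j hj
    · rw [cp_0, y0, mul_zero]
    · rw [cp_1, y1, mul_zero]
    · rw [cp_add2, y2, mul_one, Polynomial.coeff_zero_eq_eval_zero]; simp [cub]
    · intro s hs; simpa using hy s hs
    · intro s hs
      have e := congrArg (fun f => Polynomial.coeff f s) (pow_der (cub (p0 : ZMod 11) p1 p2 p3) n)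
      simp only [Polynomial.coeff_C_mul] at e
      rw [cub_coeff, cub_coeff'] at e
      simp only [Pi.zero_apply]
      linear_combination e

lemma pow_sub_dvd (P : Polynomial (ZMod 11)) (N : ℕ) (hN : 11 ∣ N) :
    (Polynomial.X ^ 10 : Polynomial (ZMod 11)) ∣ P ^ N - Polynomial.C (P.coeff 0 ^ N) := by
  obtain ⟨m, rfl⟩ := hN
  have h1 : Polynomial.X ∣ P ^ m - Polynomial.C (P.coeff 0 ^ m) := by
    rw [Polynomial.X_dvd_iff]; simp [Polynomial.coeff_zero_eq_eval_zero]
  have h2 := pow_dvd_pow_of_dvd h1 11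
  rw [sub_pow_char] at h2
  refine (pow_dvd_pow _ (by norm_num)).trans (h2.trans (dvd_of_eq ?_))
  rw [← Polynomial.C_pow, ← pow_mul, ← pow_mul, mul_comm m]

lemma LemB_true (p0 p1 p2 p3 : ℤ) (a1 a2 a3 : ZMod 11) (h1 : (p0 : ZMod 11) ≠ 0 → a1 * p0 = p1)
    (h2 : (p0 : ZMod 11) ≠ 0 → a2 * p0 = p2) (h3 : (p0 : ZMod 11) ≠ 0 → a3 * p0 = p3) (n : ℕ) (hn : 21 ≤ n)
    (y d : ℕ → ZMod 11) (y0 : y 0 = 0) (y1 : y 1 = 0) (y2 : y 2 = 1)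
    (hy : ∀ s, s < 10 → y (s+3) = (s+1) ^ 9 * (a1 * (n - s) * y (s+2) + a2 * (2*n+1-s) * y (s+1)
      + a3 * (3*n+2-s) * y s))
    (d0 : d 0 = 0) (d1 : d 1 = 0) (d2 : d 2 = 0)
    (hd : ∀ s, s < 10 → d (s+3) = (s+1) ^ 9 * (a1 * (n - s) * d (s+2) + a2 * (2*n+1-s) * d (s+1)
      + a3 * (3*n+2-s) * d s + (a1 * y (s+2) + 2 * a2 * y (s+1) + 3 * a3 * y s)))
    (j : ℕ) (hj : j ≤ 12) :
    ((Em (cub p0 p1 p2 p3) n true j : ℤ) : ZMod 11) = p0 ^ n * d j := by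
  set r := n % 11 with hr
  set N := n - r with hN
  set P := cub (p0 : ZMod 11) p1 p2 p3 with hPdef
  set Q := (Qp (cub p0 p1 p2 p3) N).map (Int.castRingHom (ZMod 11)) with hQ
  have hmapP : (cub p0 p1 p2 p3).map (Int.castRingHom (ZMod 11)) = P := by rw [cub_map]; rfl
  have e0 : ((Em (cub p0 p1 p2 p3) n true j : ℤ) : ZMod 11) = cp (-(P ^ r * Q)) j := by
    have := cp_map (Int.castRingHom (ZMod 11)) (-((cub p0 p1 p2 p3) ^ r * Qp (cub p0 p1 p2 p3) N)) j
    rw [Polynomial.map_neg, Polynomial.map_mul, Polynomial.map_pow, hmapP] at this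
    simpa [Em] using this.symm
  rw [e0]
  have hQd : (Polynomial.X ^ 10 : Polynomial (ZMod 11)) ∣ 
      Polynomial.derivative Q + (Polynomial.derivative P * P ^ (N-1)) := by
    have := Polynomial.map_dvd (Int.castRingHom (ZMod 11)) (Qp_der (cub p0 p1 p2 p3) N)
    rw [Polynomial.map_sub, Polynomial.map_mul, Polynomial.map_mul, Polynomial.map_pow, Polynomial.map_pow, 
      ← Polynomial.derivative_map, ← Polynomial.derivative_map, hmapP, Polynomial.map_X, Polynomial.map_C] at this
    have e : (Int.castRingHom (ZMod 11)) 3628800 = -1 := by decide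
    rw [e] at this
    simpa [hQ] using this
  have hQ0 : Q.coeff 0 = 0 := by rw [hQ, Polynomial.coeff_map, Qp_coeff0]; simp
  have hN11 : 11 ∣ N := by omega
  have hNpos : 11 ≤ N := by omega
  by_cases hp : (p0 : ZMod 11) = 0
  · rw [hp, zero_pow (by omega), zero_mul]
    have hX : Polynomial.X ∣ P := by rw [hPdef, hp]; exact X_dvd_cub _ _ _
    have h10 : (Polynomial.X ^ 10 : Polynomial (ZMod 11)) ∣ P ^ (N-1) :=
      (pow_dvd_pow _ (by omega)).trans (pow_dvd_pow_of_dvd hX (N-1))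
    have hQ' : (Polynomial.X ^ 10 : Polynomial (ZMod 11)) ∣ Polynomial.derivative Q := by
      have := dvd_sub hQd (dvd_mul_of_dvd_right h10 (Polynomial.derivative P))
      simpa using this
    have hQX : (Polynomial.X ^ 11 : Polynomial (ZMod 11)) ∣ Q := by
      rw [Polynomial.X_pow_dvd_iff] at hQ' ⊢
      intro i hi
      cases i with
      | zero => exact hQ0
      | succ i =>
        have := hQ' i (by omega)
        rw [Polynomial.coeff_derivative] at this
        exact (mul_eq_zero.1 this).resolve_right (f11_ne i (by omega))
    exact cp_dvd _ 11 ((dvd_neg).2 (dvd_mul_of_dvd_right hQX _)) j (by omega)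
  · have hnr : (n : ZMod 11) = r := by
      rw [hr]; simp
    have hyr : ∀ j, j ≤ 12 → cp (P ^ r) j = p0 ^ r * y j := by
      intro j hj
      refine uniq11 n p0 p1 p2 p3 a1 a2 a3 (p0 ^ r) hp (h1 hp) (h2 hp) (h3 hp) y _ 0 ?_ ?_ ?_ ?_ ?_ j hj
      · rw [cp_0, y0, mul_zero]
      · rw [cp_1, y1, mul_zero]
      · rw [cp_add2, y2, mul_one, Polynomial.coeff_zero_eq_eval_zero]; simp [hPdef, cub]
      · intro s hs; simpa using hy s hs
      · intro s hs
        have e := congrArg (fun f => Polynomial.coeff f s) (pow_der P r)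
        simp only [Polynomial.coeff_C_mul] at e
        rw [hPdef, cub_coeff, cub_coeff'] at e
        simp only [Pi.zero_apply]
        rw [hnr]
        linear_combination e
    refine uniq11 n p0 p1 p2 p3 a1 a2 a3 (p0 ^ n) hp (h1 hp) (h2 hp) (h3 hp) d _ 
      (fun s => a1 * y (s+2) + 2 * a2 * y (s+1) + 3 * a3 * y s) ?_ ?_ ?_ ?_ ?_ j hj
    · rw [cp_0, d0, mul_zero]
    · rw [cp_1, d1, mul_zero]
    · rw [cp_add2, d2, mul_zero, Polynomial.coeff_neg, Polynomial.mul_coeff_zero, hQ0]; simp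
    · exact hd
    · intro s hs
      have hc0 : P.coeff 0 = p0 := by rw [hPdef, cub_coeff0]
      have hdv : (Polynomial.X ^ 10 : Polynomial (ZMod 11)) ∣
          P * Polynomial.derivative (-(P ^ r * Q)) - Polynomial.C (r : ZMod 11) * (Polynomial.derivative P * (-(P ^ r * Q)))
          - Polynomial.C ((p0 : ZMod 11) ^ N) * (Polynomial.derivative P * P ^ r) := by
        have k1 := pow_sub_dvd P N hN11
        rw [hc0] at k1
        have k2 := dvd_sub (dvd_mul_of_dvd_right k1 (P ^ r * Polynomial.derivative P))
          (dvd_mul_of_dvd_right hQd (P ^ r * P))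
        refine k2.trans (dvd_of_eq ?_)
        have k3 := pow_der P r
        have k4 : P ^ N = P * P ^ (N-1) := by rw [← pow_succ']; congr 1; omega
        rw [Polynomial.derivative_neg, Polynomial.derivative_mul, k4]
        linear_combination Q * k3
      have e := Polynomial.X_pow_dvd_iff.1 hdv s hs
      simp only [Polynomial.coeff_sub, Polynomial.coeff_C_mul] at e
      have e1 := cub_coeff (p0 : ZMod 11) p1 p2 p3 (-(P ^ r * Q)) s
      have e2 := cub_coeff' (p0 : ZMod 11) p1 p2 p3 (-(P ^ r * Q)) s
      have e3 := cub_coeff' (p0 : ZMod 11) p1 p2 p3 (P ^ r) s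
      rw [← hPdef] at e1 e2 e3
      rw [e1, e2, e3] at e
      rw [hyr _ (by omega), hyr _ (by omega), hyr _ (by omega)] at e
      have hpn : (p0 : ZMod 11) ^ n = p0 ^ N * p0 ^ r := by rw [← pow_add]; congr 1; omega
      rw [hnr, hpn]
      rw [← h1 hp, ← h2 hp, ← h3 hp] at e ⊢
      linear_combination e

end LemB

section Conn

lemma c10 : (10 : ZMod 11) = -1 := by decide
lemma m11_cast (x : ℕ) : ((m11 x : ℕ) : ZMod 11) = x := ZMod.natCast_mod x 11
lemma inv11_cast (x : ℕ) : ((inv11 x : ℕ) : ZMod 11) = (x : ZMod 11) ^ 9 := by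
  have : inv11 x = m11 (x ^ 9) := rfl
  rw [this, m11_cast]; push_cast; rfl

lemma ystep_cast (r a1 a2 a3 s y1 y2 y3 : ℕ) : ((ystep r a1 a2 a3 (1+s) y1 y2 y3 : ℕ) : ZMod 11)
    = (s+1) ^ 9 * (a1 * (r - s) * y1 + a2 * (2*r+1-s) * y2 + a3 * (3*r+2-s) * y3) := by
  have : ystep r a1 a2 a3 (1+s) y1 y2 y3 = m11 (inv11 (1+s) * (a1 * m11 (r + (1 + 10 * (1+s))) * y1
    + (a2 * m11 (2*r + (2 + 10 * (1+s))) * y2 + a3 * m11 (3*r + (3 + 10 * (1+s))) * y3))) := rfl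
  rw [this, m11_cast, Nat.cast_mul, inv11_cast]
  push_cast [m11_cast]
  rw [c10]
  ring

lemma dstep_cast (r a1 a2 a3 s y1 y2 y3 d1 d2 d3 : ℕ) :
    ((dstep r a1 a2 a3 (1+s) y1 y2 y3 d1 d2 d3 : ℕ) : ZMod 11)
    = (s+1) ^ 9 * (a1 * (r - s) * d1 + a2 * (2*r+1-s) * d2 + a3 * (3*r+2-s) * d3
      + (a1 * y1 + 2 * a2 * y2 + 3 * a3 * y3)) := by
  have : dstep r a1 a2 a3 (1+s) y1 y2 y3 d1 d2 d3 = m11 (ystep r a1 a2 a3 (1+s) d1 d2 d3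
    + inv11 (1+s) * (a1 * y1 + (2 * (a2 * y2) + 3 * (a3 * y3)))) := rfl
  rw [this, m11_cast, Nat.cast_add, Nat.cast_mul, inv11_cast, ystep_cast]
  push_cast
  ring

/-- integer table -/
def mtab : Fin 9 → Fin 3 → ℤ :=
  ![![1, 3, 9], ![-10, 1, 4], ![8, 4, 6],
    ![1, 6, -10], ![4, -8, -10], ![-3, 7, -4],
    ![0, -3, 2], ![8, -4, -4], ![-10, 4, 6]]

def mz (i : ℕ) : Fin 3 → ℤ := mtab (Fin.ofNat 9 i)

def zA (u v : Fin 3 → ℤ) : ℤ := u 1 * v 2 - u 2 * v 1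
def zB (mu : ℕ) (u v : Fin 3 → ℤ) : ℤ := u 2 * v 0 - u 0 * v 2 + mu * (u 0 * v 1 - u 1 * v 0)
def zD (u v w : Fin 3 → ℤ) : ℤ := u 0 * (v 1 * w 2 - v 2 * w 1) - u 1 * (v 0 * w 2 - v 2 * w 0)
  + u 2 * (v 0 * w 1 - v 1 * w 0)
def zp0 (u v w : Fin 3 → ℤ) : ℤ := zD u v w * (zA u v * zA u w * zA v w)

def PP (mu : ℕ) (u v w : Fin 3 → ℤ) : Polynomial ℤ :=
  cub (zp0 u v w)
    (zD u v w * (zB mu u v * zA u w * zA v w + zA u v * zB mu u w * zA v w + zA u v * zA u w * zB mu v w))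
    (zD u v w * (zB mu u v * zB mu u w * zA v w + zB mu u v * zA u w * zB mu v w + zA u v * zB mu u w * zB mu v w))
    (zD u v w * (zB mu u v * zB mu u w * zB mu v w))

lemma mv_cast : ∀ i, i < 9 → (((mv i).a : ZMod 11) = ((mz i 0 : ℤ) : ZMod 11)) ∧
    (((mv i).b : ZMod 11) = ((mz i 1 : ℤ) : ZMod 11)) ∧ (((mv i).c : ZMod 11) = ((mz i 2 : ℤ) : ZMod 11)) := by
  decide

lemma dA_cast (i k : ℕ) (hi : i < 9) (hk : k < 9) :
    ((dA (mv i) (mv k) : ℕ) : ZMod 11) = ((zA (mz i) (mz k) : ℤ) : ZMod 11) := by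
  have : dA (mv i) (mv k) = m11 ((mv i).b * (mv k).c + 10 * ((mv i).c * (mv k).b)) := rfl
  rw [this, m11_cast, zA]
  obtain ⟨h1, h2, h3⟩ := mv_cast i hi
  obtain ⟨k1, k2, k3⟩ := mv_cast k hk
  push_cast
  rw [h2, h3, k2, k3, c10]; ring

lemma dB_cast (mu i k : ℕ) (hi : i < 9) (hk : k < 9) :
    ((dB mu (mv i) (mv k) : ℕ) : ZMod 11) = ((zB mu (mz i) (mz k) : ℤ) : ZMod 11) := by
  have : dB mu (mv i) (mv k) = m11 ((mv i).c * (mv k).a + 10 * ((mv i).a * (mv k).c) 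
    + mu * ((mv i).a * (mv k).b + 10 * ((mv i).b * (mv k).a))) := rfl
  rw [this, m11_cast, zB]
  obtain ⟨h1, h2, h3⟩ := mv_cast i hi
  obtain ⟨k1, k2, k3⟩ := mv_cast k hk
  push_cast
  rw [h1, h2, h3, k1, k2, k3, c10]; ring

lemma q11_cast (mu i k : ℕ) (hi : i < 9) (hk : k < 9) :
    ((q11 mu (mv i) (mv k) : ℕ) : ZMod 11)
     = ((zB mu (mz i) (mz k) : ℤ) : ZMod 11) * ((zA (mz i) (mz k) : ℤ) : ZMod 11) ^ 9 := by
  rw [q11, m11_cast, Nat.cast_mul, inv11_cast, dA_cast i k hi hk, dB_cast mu i k hi hk]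

lemma Em_cast (n : ℕ) (hn : 21 ≤ n) (mu i k q : ℕ) (hi : i < 9) (hk : k < 9) (hq : q < 9) (du : Bool)
    (j : ℕ) (hj : j ≤ 12) :
    ((Em (PP mu (mz i) (mz k) (mz q)) n du j : ℤ) : ZMod 11)
      = ((zp0 (mz i) (mz k) (mz q) : ℤ) : ZMod 11) ^ n * (yv du (n % 11) mu (i, k, q) j : ℕ) := by
  have hr : (((n % 11 : ℕ)) : ZMod 11) = n := ZMod.natCast_mod n 11
  have hA : ((zp0 (mz i) (mz k) (mz q) : ℤ) : ZMod 11) ≠ 0 → 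
      ((zA (mz i) (mz k) : ℤ) : ZMod 11) ^ 9 * ((zA (mz i) (mz k) : ℤ) : ZMod 11) = 1 ∧ 
      ((zA (mz i) (mz q) : ℤ) : ZMod 11) ^ 9 * ((zA (mz i) (mz q) : ℤ) : ZMod 11) = 1 ∧ 
      ((zA (mz k) (mz q) : ℤ) : ZMod 11) ^ 9 * ((zA (mz k) (mz q) : ℤ) : ZMod 11) = 1 := by
    intro h
    rw [zp0] at h
    push_cast at h
    refine ⟨f11_inv _ ?_, f11_inv _ ?_, f11_inv _ ?_⟩ <;> (intro h0; rw [h0] at h; simp at h)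
  have c1 : ((zp0 (mz i) (mz k) (mz q) : ℤ) : ZMod 11) ≠ 0 →
    ((e1 mu (mv i) (mv k) (mv q) : ℕ) : ZMod 11) * ((zp0 (mz i) (mz k) (mz q) : ℤ) : ZMod 11) =
      ((zD (mz i) (mz k) (mz q) * (zB mu (mz i) (mz k) * zA (mz i) (mz q) * zA (mz k) (mz q) + zA (mz i) (mz k) * zB mu (mz i) (mz q) * zA (mz k) (mz q) + zA (mz i) (mz k) * zA (mz i) (mz q) * zB mu (mz k) (mz q)) : ℤ) : ZMod 11) := by
    intro h
    obtain ⟨h1, h2, h3⟩ := hA h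
    rw [e1, m11_cast]
    push_cast [q11_cast mu i k hi hk, q11_cast mu i q hi hq, q11_cast mu k q hk hq, zp0]
    generalize ((zD (mz i) (mz k) (mz q) : ℤ) : ZMod 11) = D at *
    generalize ((zA (mz i) (mz k) : ℤ) : ZMod 11) = A1 at *
    generalize ((zA (mz i) (mz q) : ℤ) : ZMod 11) = A2 at *
    generalize ((zA (mz k) (mz q) : ℤ) : ZMod 11) = A3 at *
    linear_combination D * zB mu (mz i) (mz k) * A2 * A3 * h1 + D * zB mu (mz i) (mz q) * A1 * A3 * h2
      + D * zB mu (mz k) (mz q) * A1 * A2 * h3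
  have c2 : ((zp0 (mz i) (mz k) (mz q) : ℤ) : ZMod 11) ≠ 0 →
    ((e2 mu (mv i) (mv k) (mv q) : ℕ) : ZMod 11) * ((zp0 (mz i) (mz k) (mz q) : ℤ) : ZMod 11) =
      ((zD (mz i) (mz k) (mz q) * (zB mu (mz i) (mz k) * zB mu (mz i) (mz q) * zA (mz k) (mz q) + zB mu (mz i) (mz k) * zA (mz i) (mz q) * zB mu (mz k) (mz q) + zA (mz i) (mz k) * zB mu (mz i) (mz q) * zB mu (mz k) (mz q)) : ℤ) : ZMod 11) := by
    intro h
    obtain ⟨h1, h2, h3⟩ := hA h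
    rw [e2, m11_cast]
    push_cast [q11_cast mu i k hi hk, q11_cast mu i q hi hq, q11_cast mu k q hk hq, zp0]
    generalize ((zD (mz i) (mz k) (mz q) : ℤ) : ZMod 11) = D at *
    generalize ((zA (mz i) (mz k) : ℤ) : ZMod 11) = A1 at *
    generalize ((zA (mz i) (mz q) : ℤ) : ZMod 11) = A2 at *
    generalize ((zA (mz k) (mz q) : ℤ) : ZMod 11) = A3 at *
    generalize ((zB mu (mz i) (mz k) : ℤ) : ZMod 11) = B1 at *
    generalize ((zB mu (mz i) (mz q) : ℤ) : ZMod 11) = B2 at *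
    generalize ((zB mu (mz k) (mz q) : ℤ) : ZMod 11) = B3 at *
    have h12 : A1 ^ 9 * A1 * (A2 ^ 9 * A2) = 1 := by rw [h1, h2, one_mul]
    have h13 : A1 ^ 9 * A1 * (A3 ^ 9 * A3) = 1 := by rw [h1, h3, one_mul]
    have h23 : A2 ^ 9 * A2 * (A3 ^ 9 * A3) = 1 := by rw [h2, h3, one_mul]
    linear_combination D * B1 * B2 * A3 * h12 + D * B1 * B3 * A2 * h13 + D * B2 * B3 * A1 * h23
  have c3 : ((zp0 (mz i) (mz k) (mz q) : ℤ) : ZMod 11) ≠ 0 →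
    ((e3 mu (mv i) (mv k) (mv q) : ℕ) : ZMod 11) * ((zp0 (mz i) (mz k) (mz q) : ℤ) : ZMod 11) =
      ((zD (mz i) (mz k) (mz q) * (zB mu (mz i) (mz k) * zB mu (mz i) (mz q) * zB mu (mz k) (mz q)) : ℤ) : ZMod 11) := by
    intro h
    obtain ⟨h1, h2, h3⟩ := hA h
    rw [e3, m11_cast]
    push_cast [q11_cast mu i k hi hk, q11_cast mu i q hi hq, q11_cast mu k q hk hq, zp0]
    generalize ((zD (mz i) (mz k) (mz q) : ℤ) : ZMod 11) = D at *
    generalize ((zA (mz i) (mz k) : ℤ) : ZMod 11) = A1 at *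
    generalize ((zA (mz i) (mz q) : ℤ) : ZMod 11) = A2 at *
    generalize ((zA (mz k) (mz q) : ℤ) : ZMod 11) = A3 at *
    generalize ((zB mu (mz i) (mz k) : ℤ) : ZMod 11) = B1 at *
    generalize ((zB mu (mz i) (mz q) : ℤ) : ZMod 11) = B2 at *
    generalize ((zB mu (mz k) (mz q) : ℤ) : ZMod 11) = B3 at *
    have h123 : A1 ^ 9 * A1 * (A2 ^ 9 * A2) * (A3 ^ 9 * A3) = 1 := by rw [h1, h2, h3, one_mul, one_mul]
    linear_combination D * B1 * B2 * B3 * h123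
  have Y0 : ((yv false (n % 11) mu (i, k, q) 0 : ℕ) : ZMod 11) = 0 := by simp [yv]
  have Y1 : ((yv false (n % 11) mu (i, k, q) 1 : ℕ) : ZMod 11) = 0 := by simp [yv]
  have Y2 : ((yv false (n % 11) mu (i, k, q) 2 : ℕ) : ZMod 11) = 1 := by simp [yv, tl_false]
  have hY : ∀ s, s < 10 → ((yv false (n % 11) mu (i, k, q) (s+3) : ℕ) : ZMod 11) =
      (s+1) ^ 9 * (((e1 mu (mv i) (mv k) (mv q) : ℕ) : ZMod 11) * (n - s) * (yv false (n % 11) mu (i, k, q) (s+2) : ℕ)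
      + ((e2 mu (mv i) (mv k) (mv q) : ℕ) : ZMod 11) * (2*n+1-s) * (yv false (n % 11) mu (i, k, q) (s+1) : ℕ)
      + ((e3 mu (mv i) (mv k) (mv q) : ℕ) : ZMod 11) * (3*n+2-s) * (yv false (n % 11) mu (i, k, q) s : ℕ)) := by
    intro s hs
    rw [yv_rec _ _ _ _ hs, ystep_cast, hr]
  cases du with
  | false =>
    exact LemB_false _ _ _ _ _ _ _ c1 c2 c3 n hn
      (fun j => ((yv false (n % 11) mu (i, k, q) j : ℕ) : ZMod 11)) Y0 Y1 Y2 hY j hj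
  | true =>
    refine LemB_true _ _ _ _ _ _ _ c1 c2 c3 n hn
      (fun j => ((yv false (n % 11) mu (i, k, q) j : ℕ) : ZMod 11)) 
      (fun j => ((yv true (n % 11) mu (i, k, q) j : ℕ) : ZMod 11)) Y0 Y1 Y2 hY ?_ ?_ ?_ ?_ j hj
    · simp [yv]
    · simp [yv]
    · simp [yv, tl_true]
    · intro s hs
      rw [dv_rec _ _ _ _ hs, dstep_cast, hr]

end Conn

section Sym

lemma sym6 {M : Type*} [AddCommMonoid M] (F : ℕ → ℕ → ℕ → M) (h1 : ∀ i k q, F i k q = F k i q)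
    (h2 : ∀ i k q, F i k q = F i q k) (h0 : ∀ i q, F i i q = 0) (s : Finset ℕ) :
    ∑ i ∈ s, ∑ k ∈ s, ∑ q ∈ s, F i k q
      = 6 • ∑ i ∈ s, ∑ k ∈ s, ∑ q ∈ s, (if i < k ∧ k < q then F i k q else 0) := by
  set G : ℕ → ℕ → ℕ → M := fun i k q => if i < k ∧ k < q then F i k q else 0 with hG
  have h0' : ∀ i q, F q i i = 0 := fun i q => by rw [h1, h2, h0]
  have h0'' : ∀ i q, F i q i = 0 := fun i q => by rw [h2, h0]
  have key : ∀ i k q, F i k q = G i k q + G i q k + G k i q + G k q i + G q i k + G q k i := by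
    intro i k q
    simp only [hG]
    rcases lt_trichotomy i k with a | a | a <;> rcases lt_trichotomy k q with b | b | b <;>
      rcases lt_trichotomy i q with c | c | c <;> first | omega | skip
    all_goals (try subst a)
    all_goals (try subst b)
    all_goals (try subst c)
    all_goals (try simp only [h0, h0', h0''])
    all_goals (try simp only [lt_irrefl, false_and, and_false, if_false, add_zero, zero_add])
    all_goals (try simp only [a, b, c, not_lt_of_gt a, not_lt_of_gt b, not_lt_of_gt c, and_true, true_and, if_true, if_false, false_and, and_false,
      add_zero, zero_add])
    all_goals (try simp only [a, not_lt_of_gt a, and_true, true_and, if_true, if_false, false_and, and_false,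
      add_zero, zero_add])
    all_goals (try simp only [b, not_lt_of_gt b, and_true, true_and, if_true, if_false, false_and, and_false,
      add_zero, zero_add])
    all_goals first | exact h2 _ _ _ | exact h1 _ _ _ | (rw [h1, h2]; done) | (rw [h2, h1]; done) | (rw [h1, h2, h1]; done) | (rw [h2, h1, h2]; done) | skip
  have p1 : ∑ i ∈ s, ∑ k ∈ s, ∑ q ∈ s, G i q k = ∑ i ∈ s, ∑ k ∈ s, ∑ q ∈ s, G i k q :=
    Finset.sum_congr rfl fun i _ => Finset.sum_comm
  have p2 : ∑ i ∈ s, ∑ k ∈ s, ∑ q ∈ s, G k i q = ∑ i ∈ s, ∑ k ∈ s, ∑ q ∈ s, G i k q :=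
    Finset.sum_comm
  have p3 : ∑ i ∈ s, ∑ k ∈ s, ∑ q ∈ s, G k q i = ∑ i ∈ s, ∑ k ∈ s, ∑ q ∈ s, G i k q := by
    rw [Finset.sum_comm]; exact Finset.sum_congr rfl fun i _ => Finset.sum_comm
  have p4 : ∑ i ∈ s, ∑ k ∈ s, ∑ q ∈ s, G q i k = ∑ i ∈ s, ∑ k ∈ s, ∑ q ∈ s, G i k q := by
    rw [← p2]; exact Finset.sum_congr rfl fun i _ => Finset.sum_comm
  have p5 : ∑ i ∈ s, ∑ k ∈ s, ∑ q ∈ s, G q k i = ∑ i ∈ s, ∑ k ∈ s, ∑ q ∈ s, G i k q := by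
    rw [← p3]; exact Finset.sum_congr rfl fun i _ => Finset.sum_comm
  have hL : ∑ i ∈ s, ∑ k ∈ s, ∑ q ∈ s, F i k q = ∑ i ∈ s, ∑ k ∈ s, ∑ q ∈ s,
      (G i k q + G i q k + G k i q + G k q i + G q i k + G q k i) :=
    Finset.sum_congr rfl fun i _ => Finset.sum_congr rfl fun k _ => Finset.sum_congr rfl fun q _ => key i k q
  rw [hL]
  simp only [Finset.sum_add_distrib]
  rw [p1, p2, p3, p4, p5]
  simp only [succ_nsmul, zero_nsmul, zero_add]
  rfl

def S9 : Finset (ℕ × ℕ × ℕ) :=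
  (Finset.range 9 ×ˢ (Finset.range 9 ×ˢ Finset.range 9)).filter fun e => e.1 < e.2.1 ∧ e.2.1 < e.2.2

lemma sum_S9 {M : Type*} [AddCommMonoid M] (F : ℕ → ℕ → ℕ → M) :
    ∑ i ∈ Finset.range 9, ∑ k ∈ Finset.range 9, ∑ q ∈ Finset.range 9, (if i < k ∧ k < q then F i k q else 0)
      = ∑ e ∈ S9, F e.1 e.2.1 e.2.2 := by
  rw [S9, Finset.sum_filter, Finset.sum_product]
  refine Finset.sum_congr rfl fun i _ => ?_
  rw [Finset.sum_product]

def tabF : List (ℕ × ℕ × ℕ) := tab.flatMap (fun t => t.2)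
def z0 (e : ℕ × ℕ × ℕ) : ZMod 11 := ((zp0 (mz e.1) (mz e.2.1) (mz e.2.2) : ℤ) : ZMod 11)

lemma tabF_nodup : tabF.Nodup := by decide +kernel
lemma tab_val : ∀ t ∈ tab, ∀ e ∈ t.2, z0 e = (t.1 : ZMod 11) := by decide +kernel
lemma tab_ne : ∀ t ∈ tab, (t.1 : ZMod 11) ≠ 0 := by decide +kernel
lemma tabF_mem1 : ∀ e ∈ tabF, e ∈ S9 := by
  have : ∀ e ∈ tabF, e.1 < 9 ∧ e.2.1 < 9 ∧ e.2.2 < 9 ∧ e.1 < e.2.1 ∧ e.2.1 < e.2.2 := by decide +kernel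
  intro e he
  simp only [S9, Finset.mem_filter, Finset.mem_product, Finset.mem_range]
  have := this e he
  tauto
lemma tabF_mem2 : ∀ e ∈ S9, z0 e ≠ 0 → e ∈ tabF := by
  have h9 : ∀ e ∈ (List.range 9).product ((List.range 9).product (List.range 9)),
      z0 e = 0 ∨ e ∈ tabF ∨ ¬ (e.1 < e.2.1) ∨ ¬ (e.2.1 < e.2.2) := by
    decide +kernel
  rintro ⟨i, k, q⟩ he
  simp only [S9, Finset.mem_filter, Finset.mem_product, Finset.mem_range] at he
  have := h9 (i, k, q) (by
    simp only [List.product, List.mem_flatMap, List.mem_map, List.mem_range]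
    exact ⟨i, he.1.1, _, ⟨k, he.1.2.1, q, he.1.2.2, rfl⟩, rfl⟩)
  simp only at this
  intro h0
  rcases this with h | h | h | h
  · exact absurd h h0
  · exact h
  · exact absurd he.2.1 h
  · exact absurd he.2.2 h

lemma tab_sum {M : Type*} [AddCommMonoid M] [Module (ZMod 11) M] (n : ℕ) (hn : 1 ≤ n) (f : ℕ × ℕ × ℕ → M) :
    ∑ e ∈ S9, z0 e ^ n • f e = (tab.map fun t => ((t.1 ^ (n % 10) % 11 : ℕ) : ZMod 11) • (t.2.map f).sum).sum := by
  have h1 : ∑ e ∈ S9, z0 e ^ n • f e = ∑ e ∈ tabF.toFinset, z0 e ^ n • f e := by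
    symm
    apply Finset.sum_subset
    · intro e he; exact tabF_mem1 e (List.mem_toFinset.1 he)
    · intro e he hne
      have : z0 e = 0 := by
        by_contra h
        exact hne (List.mem_toFinset.2 (tabF_mem2 e he h))
      rw [this, zero_pow (by omega), zero_smul]
  rw [h1, List.sum_toFinset _ tabF_nodup]
  have h2 : ∀ T : List (ℕ × List (ℕ × ℕ × ℕ)), (∀ t ∈ T, t ∈ tab) → 
    ((T.flatMap (fun t => t.2)).map fun e => z0 e ^ n • f e).sum
      = (T.map fun t => ((t.1 ^ (n % 10) % 11 : ℕ) : ZMod 11) • (t.2.map f).sum).sum := by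
    intro T
    induction T with
    | nil => intro _; simp
    | cons t T ih =>
      intro hT
      have ht := hT t (by simp)
      rw [List.flatMap_cons, List.map_append, List.sum_append, ih (fun t ht => hT t (by simp [ht])),
        List.map_cons, List.sum_cons]
      congr 1
      have hg : ((t.1 ^ (n % 10) % 11 : ℕ) : ZMod 11) = (t.1 : ZMod 11) ^ n := by
        rw [ZMod.natCast_mod]; push_cast
        conv_rhs => rw [← Nat.div_add_mod n 10, pow_add, pow_mul]
        have : (t.1 : ZMod 11) ^ 10 = 1 := ZMod.pow_card_sub_one_eq_one (tab_ne t ht)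
        rw [this, one_pow, one_mul]
      have hv := tab_val t ht
      rw [hg, List.smul_sum, List.map_map]
      congr 1
      apply List.map_congr_left
      intro e he
      simp [hv e he]
  exact h2 tab (fun _ h => h)

end Sym

section Rows

def Kz (u : Fin 3 → ℤ) : Polynomial ℤ :=
  Polynomial.C (u 0) + (Polynomial.C (u 1) * Polynomial.X + Polynomial.C (u 2) * Polynomial.X ^ 9)
def KK (u v w : Fin 3 → ℤ) : Polynomial ℤ := (Kz u * (Kz v * Kz w)) ^ 2
def Uz (mu : ℕ) : Polynomial ℤ := Polynomial.X + Polynomial.C (mu : ℤ) * Polynomial.X ^ 9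
def RT (n : ℕ) (du : Bool) (mu s : ℕ) (u v w : Fin 3 → ℤ) : Polynomial ℤ :=
  (Polynomial.C (Em (PP mu u v w) n du (s+2)) + (2 * Uz mu * Polynomial.C (Em (PP mu u v w) n du (s+1))
    + Uz mu * Uz mu * Polynomial.C (Em (PP mu u v w) n du s))) * KK u v w
def RS (n : ℕ) (du : Bool) (mu s : ℕ) : Polynomial ℤ :=
  ∑ i ∈ Finset.range 9, ∑ k ∈ Finset.range 9, ∑ q ∈ Finset.range 9, RT n du mu s (mz i) (mz k) (mz q)

lemma PP_sw1 (mu : ℕ) (u v w : Fin 3 → ℤ) : PP mu u v w = PP mu v u w := by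
  unfold PP; congr 1 <;> simp only [zp0, zD, zA, zB] <;> ring
lemma PP_sw2 (mu : ℕ) (u v w : Fin 3 → ℤ) : PP mu u v w = PP mu u w v := by
  unfold PP; congr 1 <;> simp only [zp0, zD, zA, zB] <;> ring
lemma PP_dg (mu : ℕ) (u w : Fin 3 → ℤ) : PP mu u u w = 0 := by
  have : zD u u w = 0 := by simp only [zD]; ring
  unfold PP; simp [zp0, this, cub]
lemma Em_zero (n : ℕ) (hn : 1 ≤ n) (du : Bool) (j : ℕ) : Em 0 n du j = 0 := by
  cases du
  · simp [Em, zero_pow (by omega : n ≠ 0), cp]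
  · simp [Em, Qp, cp]

lemma RT_sw1 (n : ℕ) (du : Bool) (mu s : ℕ) (u v w : Fin 3 → ℤ) : RT n du mu s u v w = RT n du mu s v u w := by
  unfold RT; rw [PP_sw1 mu u v w, show KK u v w = KK v u w by unfold KK; ring]
lemma RT_sw2 (n : ℕ) (du : Bool) (mu s : ℕ) (u v w : Fin 3 → ℤ) : RT n du mu s u v w = RT n du mu s u w v := by
  unfold RT; rw [PP_sw2 mu u v w, show KK u v w = KK u w v by unfold KK; ring]
lemma RT_dg (n : ℕ) (hn : 1 ≤ n) (du : Bool) (mu s : ℕ) (u w : Fin 3 → ℤ) : RT n du mu s u u w = 0 := by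
  unfold RT; rw [PP_dg]; simp [Em_zero n hn]

lemma lam_congr (Λ : Polynomial ℤ →+ ZMod 11) (f g : Polynomial ℤ)
    (h : f.map (Int.castRingHom (ZMod 11)) = g.map (Int.castRingHom (ZMod 11))) : Λ f = Λ g := by
  have h1 : Polynomial.C (11 : ℤ) ∣ f - g := by
    rw [Polynomial.C_dvd_iff_dvd_coeff]
    intro i
    have := congrArg (fun p => Polynomial.coeff p i) h
    simp only [Polynomial.coeff_map, eq_intCast] at this
    rw [Polynomial.coeff_sub]
    have h2 : ((f.coeff i - g.coeff i : ℤ) : ZMod 11) = 0 := by push_cast; rw [this, sub_self]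
    exact_mod_cast (ZMod.intCast_zmod_eq_zero_iff_dvd _ 11).1 h2
  obtain ⟨q, hq⟩ := h1
  have h3 : Λ (f - g) = 0 := by
    rw [hq]
    have : Polynomial.C (11 : ℤ) * q = 11 • q := by simp
    rw [this, map_nsmul]
    simp only [nsmul_eq_mul]
    have : ((11 : ℕ) : ZMod 11) = 0 := by decide
    rw [this, zero_mul]
  rw [map_sub, sub_eq_zero] at h3
  exact h3

abbrev pi11 : Polynomial ℤ →+* Polynomial (ZMod 11) := Polynomial.mapRingHom (Int.castRingHom (ZMod 11))
abbrev nu11 : Polynomial ℕ →+* Polynomial (ZMod 11) := Polynomial.mapRingHom (Nat.castRingHom (ZMod 11))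

/-- the per-triple row mod 11 -/
def f0 (n : ℕ) (du : Bool) (mu s : ℕ) (e : ℕ × ℕ × ℕ) : Polynomial (ZMod 11) :=
  (Polynomial.C ((yv du (n % 11) mu e (s+2) : ℕ) : ZMod 11)
    + (2 * nu11 (uP mu) * Polynomial.C ((yv du (n % 11) mu e (s+1) : ℕ) : ZMod 11)
      + nu11 (uP mu) * nu11 (uP mu) * Polynomial.C ((yv du (n % 11) mu e s : ℕ) : ZMod 11))) * nu11 (kTe e)

lemma pi_Uz (mu : ℕ) : pi11 (Uz mu) = nu11 (uP mu) := by
  simp [Uz, uP]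

lemma pi_Kz (i : ℕ) (hi : i < 9) : pi11 (Kz (mz i)) = nu11 (kEP (mv i)) := by
  obtain ⟨h1, h2, h3⟩ := mv_cast i hi
  have hC : ∀ x : ℤ, pi11 (Polynomial.C x) = Polynomial.C (x : ZMod 11) := fun x => by simp
  have hD : ∀ x : ℕ, nu11 (Polynomial.C x) = Polynomial.C (x : ZMod 11) := fun x => by simp
  have hX : pi11 Polynomial.X = Polynomial.X := by simp
  have hY : nu11 Polynomial.X = Polynomial.X := by simp
  simp only [Kz, kEP, map_add, map_mul, map_pow, hX, hY]
  rw [hC, hC, hC, hD, hD, hD, h1, h2, h3]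

lemma pi_KK (i k q : ℕ) (hi : i < 9) (hk : k < 9) (hq : q < 9) :
    pi11 (KK (mz i) (mz k) (mz q)) = nu11 (kTe (i, k, q)) := by
  rw [KK, kTe, kTP]
  simp only [map_pow, map_mul, pi_Kz _ hi, pi_Kz _ hk, pi_Kz _ hq]

lemma pi_RT (n : ℕ) (hn : 21 ≤ n) (du : Bool) (mu s : ℕ) (hs : s < 11) (i k q : ℕ) (hi : i < 9) (hk : k < 9) (hq : q < 9) :
    pi11 (RT n du mu s (mz i) (mz k) (mz q)) = z0 (i, k, q) ^ n • f0 n du mu s (i, k, q) := by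
  have hC : ∀ x : ℤ, pi11 (Polynomial.C x) = Polynomial.C (x : ZMod 11) := fun x => by simp
  rw [RT, f0, Polynomial.smul_eq_C_mul]
  simp only [map_mul, map_add, pi_KK i k q hi hk hq, pi_Uz, hC, Em_cast n hn mu i k q hi hk hq du _ (by omega : s + 2 ≤ 12),
    Em_cast n hn mu i k q hi hk hq du _ (by omega : s + 1 ≤ 12), Em_cast n hn mu i k q hi hk hq du _ (by omega : s ≤ 12),
    map_ofNat, z0, map_pow]
  ring

lemma pi_RS (n : ℕ) (hn : 21 ≤ n) (du : Bool) (mu s : ℕ) (hs : s < 11) :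
    pi11 (RS n du mu s) = 6 • ∑ e ∈ S9, z0 e ^ n • f0 n du mu s e := by
  have h6 := sym6 (fun i k q => pi11 (RT n du mu s (mz i) (mz k) (mz q)))
    (fun i k q => by rw [RT_sw1]) (fun i k q => by rw [RT_sw2])
    (fun i q => by rw [RT_dg n (by omega), map_zero]) (Finset.range 9)
  have h7 := sum_S9 (fun i k q => pi11 (RT n du mu s (mz i) (mz k) (mz q)))
  have h8 : pi11 (RS n du mu s) = ∑ i ∈ Finset.range 9, ∑ k ∈ Finset.range 9, ∑ q ∈ Finset.range 9,
      pi11 (RT n du mu s (mz i) (mz k) (mz q)) := by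
    rw [RS]; simp only [map_sum]
  have h9 : ∑ e ∈ S9, pi11 (RT n du mu s (mz e.1) (mz e.2.1) (mz e.2.2)) = ∑ e ∈ S9, z0 e ^ n • f0 n du mu s e := ?_
  · rw [h8, h6, h7, h9, nsmul_eq_mul]
  refine Finset.sum_congr rfl fun e he => ?_
  obtain ⟨i, k, q⟩ := e
  simp only [S9, Finset.mem_filter, Finset.mem_product, Finset.mem_range] at he
  exact pi_RT n hn du mu s hs i k q he.1.1 he.1.2.1 he.1.2.2

lemma nu_gP (du : Bool) (r mu : ℕ) (l : List (ℕ × ℕ × ℕ)) (j : ℕ) :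
    nu11 (gP du r mu l j) = (l.map fun e => Polynomial.C ((yv du r mu e j : ℕ) : ZMod 11) * nu11 (kTe e)).sum := by
  unfold gP
  rw [map_list_sum, List.map_map]
  congr 1
  apply List.map_congr_left
  intro e _
  simp

lemma nu_fP (n : ℕ) (du : Bool) (mu s : ℕ) :
    nu11 (fP du (n % 11) mu (n % 10) s)
      = (tab.map fun t => ((t.1 ^ (n % 10) % 11 : ℕ) : ZMod 11) • (t.2.map (f0 n du mu s)).sum).sum := by
  have hr : ∀ T j, nu11 (rP du (n % 11) mu (n % 10) T j)
      = (T.map fun t => Polynomial.C ((t.1 ^ (n % 10) % 11 : ℕ) : ZMod 11) * nu11 (gP du (n % 11) mu t.2 j)).sum := by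
    intro T j
    unfold rP
    rw [map_list_sum, List.map_map]
    congr 1
    apply List.map_congr_left
    intro e _
    have hD : ∀ x : ℕ, nu11 (Polynomial.C x) = Polynomial.C (x : ZMod 11) := fun x => by simp
    rw [Function.comp_apply, map_mul, hD]
  rw [fP]
  simp only [map_add, map_mul, hr, map_ofNat]
  generalize tab = T
  have hl : ∀ l : List (ℕ × ℕ × ℕ), (l.map (f0 n du mu s)).sum = nu11 (gP du (n % 11) mu l (s+2))
      + (2 * nu11 (uP mu) * nu11 (gP du (n % 11) mu l (s+1)) + nu11 (uP mu) * nu11 (uP mu) * nu11 (gP du (n % 11) mu l s)) := by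
    intro l
    simp only [nu_gP]
    induction l with
    | nil => simp
    | cons e l ih =>
      simp only [List.map_cons, List.sum_cons, ih, f0]
      ring
  induction T with
  | nil => simp
  | cons t T ih =>
    simp only [List.map_cons, List.sum_cons]
    rw [← ih, hl, Polynomial.smul_eq_C_mul]
    ring

lemma row_lift (n : ℕ) (hn : 21 ≤ n) (du : Bool) (mu s : ℕ) (hs : s < 11) (Λ : Polynomial ℤ →+ ZMod 11)
    (h : Λ (RS n du mu s) = 0) :
    Λ ((fP du (n % 11) mu (n % 10) s).map (Nat.castRingHom ℤ)) = 0 := by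
  have h1 : Λ (RS n du mu s) = Λ (6 • (fP du (n % 11) mu (n % 10) s).map (Nat.castRingHom ℤ)) := by
    apply lam_congr
    have e1 := pi_RS n hn du mu s hs
    have e2 := e1.trans (congrArg (fun z => 6 • z) ((tab_sum n (by omega) (f0 n du mu s)).trans (nu_fP n du mu s).symm))
    have e3 : pi11 (6 • (fP du (n % 11) mu (n % 10) s).map (Nat.castRingHom ℤ)) = 6 • nu11 (fP du (n % 11) mu (n % 10) s) := by
      rw [map_nsmul]
      congr 1
      rw [Polynomial.coe_mapRingHom, Polynomial.coe_mapRingHom, Polynomial.map_map]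
      congr 1
    exact e2.trans e3.symm
  rw [h, map_nsmul, nsmul_eq_mul] at h1
  have h6 : ((6 : ℕ) : ZMod 11) ≠ 0 := by decide
  exact (mul_eq_zero.1 h1.symm).resolve_left h6

end Rows

theorem c_0 : chkR 0 = true := by decide +kernel
theorem c_1 : chkR 1 = true := by decide +kernel
theorem c_2 : chkR 2 = true := by decide +kernel
theorem c_3 : chkR 3 = true := by decide +kernel
theorem c_4 : chkR 4 = true := by decide +kernel
theorem c_5 : chkR 5 = true := by decide +kernel
theorem c_6 : chkR 6 = true := by decide +kernel
theorem c_7 : chkR 7 = true := by decide +kernel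
theorem c_8 : chkR 8 = true := by decide +kernel
theorem c_9 : chkR 9 = true := by decide +kernel
theorem c_10 : chkR 10 = true := by decide +kernel
lemma chkR_imp (r rho : ℕ) (hr : rho < 10) (h : chkR r = true) : chk r rho = true := by
  have h' : (chk r 0 && (chk r 1 && (chk r 2 && (chk r 3 && (chk r 4 &&
    (chk r 5 && (chk r 6 && (chk r 7 && (chk r 8 && chk r 9))))))))) = true := h
  clear h
  generalize hc : chk r = c at *
  simp only [Bool.and_eq_true] at h'
  interval_cases rho <;> tauto
lemma chk_all (r rho : ℕ) (hr : r < 11) (hrho : rho < 10) : chk r rho = true := by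
  apply chkR_imp r rho hrho
  clear hrho rho
  have e : r = 0 ∨ r = 1 ∨ r = 2 ∨ r = 3 ∨ r = 4 ∨ r = 5 ∨ r = 6 ∨ r = 7 ∨ r = 8 ∨ r = 9 ∨ r = 10 := by omega
  rcases e with rfl | rfl | rfl | rfl | rfl | rfl | rfl | rfl | rfl | rfl | rfl
  · exact c_0
  · exact c_1
  · exact c_2
  · exact c_3
  · exact c_4
  · exact c_5
  · exact c_6
  · exact c_7
  · exact c_8
  · exact c_9
  · exact c_10

section Lift

lemma lift_lemma (f : Polynomial ℤ →+ ℂ) (hv : ∀ i, 81 ≤ i → f (Polynomial.X ^ i) = 0)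
    (hne : ∃ p, f p ≠ 0) : ∃ Λ : Polynomial ℤ →+ ZMod 11, (∀ p, f p = 0 → Λ p = 0) ∧ ∃ p, Λ p ≠ 0 := by
  let F : Polynomial ℤ →ₗ[ℤ] ℂ := f.toIntLinearMap
  have hfg : (LinearMap.range F).FG := by
    have : LinearMap.range F = Submodule.span ℤ (Set.range fun i : Fin 81 => F (Polynomial.X ^ (i : ℕ))) := by
      apply le_antisymm
      · rintro _ ⟨p, rfl⟩
        induction p using Polynomial.induction_on' with
        | add p q hp hq => rw [map_add]; exact add_mem hp hq
        | monomial i a =>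
          rw [← Polynomial.C_mul_X_pow_eq_monomial, ← Polynomial.smul_eq_C_mul, map_smul]
          apply Submodule.smul_mem
          by_cases hi : i < 81
          · exact Submodule.subset_span ⟨⟨i, hi⟩, rfl⟩
          · have : F (Polynomial.X ^ i) = 0 := hv i (by omega)
            rw [this]; exact zero_mem _
      · rw [Submodule.span_le]
        rintro _ ⟨i, rfl⟩
        exact ⟨_, rfl⟩
    rw [this]
    exact Submodule.fg_span (Set.finite_range _)
  haveI : Module.Finite ℤ (LinearMap.range F) := Module.Finite.iff_fg.2 hfg
  haveI : Module.Free ℤ (LinearMap.range F) := inferInstance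
  let b := Module.Free.chooseBasis ℤ (LinearMap.range F)
  have hex : Nonempty (Module.Free.ChooseBasisIndex ℤ (LinearMap.range F)) := by
    by_contra hemp
    rw [not_nonempty_iff] at hemp
    obtain ⟨p, hp⟩ := hne
    apply hp
    have : (⟨F p, ⟨p, rfl⟩⟩ : LinearMap.range F) = 0 := by
      apply b.repr.injective
      ext i
      exact hemp.elim i
    exact congrArg Subtype.val this
  obtain ⟨i⟩ := hex
  obtain ⟨y, hy⟩ := (b i).2
  refine ⟨(Int.castAddHom (ZMod 11)).comp ((b.coord i).comp F.rangeRestrict).toAddMonoidHom, ?_, y, ?_⟩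
  · intro p hp
    have : F.rangeRestrict p = 0 := Subtype.ext hp
    simp [this]
  · have : F.rangeRestrict y = b i := Subtype.ext hy
    simp [this]

theorem core (n : ℕ) (hn : 21 ≤ n) (f : Polynomial ℤ →+ ℂ)
    (hv : ∀ i, 9 ≤ i % 9 + i / 9 → f (Polynomial.X ^ i) = 0)
    (hrow : ∀ du mu s, mu < 6 → s < 11 → (du = true → 3 * (n % 11) + 3 ≤ s) → f (RS n du mu s) = 0) :
    ∀ p, f p = 0 := by
  by_contra hne
  push Not at hne
  obtain ⟨Λ, h1, p, hp⟩ := lift_lemma f (fun i hi => hv i (by omega)) hne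
  apply hp
  clear hp
  let L : LL := Λ.comp (Polynomial.mapRingHom (Nat.castRingHom ℤ)).toAddMonoidHom
  have hL : ∀ q, L q = Λ (q.map (Nat.castRingHom ℤ)) := fun q => rfl
  have h2 := final_mod (n % 11) (n % 10) (chk_all _ _ (by omega) (by omega)) L
    (fun i hi => by rw [hL]; apply h1; simpa using hv i hi)
    (fun du mu s hmu hs hd => by rw [hL]; exact row_lift n hn du mu s hs Λ (h1 _ (hrow du mu s hmu hs hd)))
  induction p using Polynomial.induction_on' with
  | add p q hp hq => rw [map_add, hp, hq, add_zero]
  | monomial i a =>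
    rw [← Polynomial.C_mul_X_pow_eq_monomial]
    have := h2 (Polynomial.X ^ i)
    rw [hL] at this
    simp only [Polynomial.map_pow, Polynomial.map_X] at this
    have e : Polynomial.C a * Polynomial.X ^ i = a • (Polynomial.X ^ i : Polynomial ℤ) := by
      rw [Polynomial.smul_eq_C_mul]
    rw [e, map_zsmul, this, smul_zero]

end Lift

section Kron

lemma RT_true (n : ℕ) (mu s : ℕ) (hs : s < 11) (h : 3 * (n % 11) + 3 ≤ s) (u v w : Fin 3 → ℤ) :
    Polynomial.C 3628800 * RT n false mu s u v w = Polynomial.C (-((n - n % 11 : ℕ) : ℤ)) * RT n true mu s u v w := by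
  obtain ⟨s, rfl⟩ : ∃ t, s = t + 2 := ⟨s - 2, by omega⟩
  unfold RT
  have e2 : 3628800 * Em (PP mu u v w) n false (s+2+2) = -((n - n % 11 : ℕ) : ℤ) * Em (PP mu u v w) n true (s+2+2) :=
    Em_true _ _ _ _ n (s+2) hs (by omega)
  have e1 : 3628800 * Em (PP mu u v w) n false (s+1+2) = -((n - n % 11 : ℕ) : ℤ) * Em (PP mu u v w) n true (s+1+2) :=
    Em_true _ _ _ _ n (s+1) (by omega) (by omega)
  have e0 : 3628800 * Em (PP mu u v w) n false (s+2) = -((n - n % 11 : ℕ) : ℤ) * Em (PP mu u v w) n true (s+2) :=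
    Em_true _ _ _ _ n s (by omega) (by omega)
  have f2 := congrArg (Polynomial.C : ℤ → Polynomial ℤ) e2
  have f1 := congrArg (Polynomial.C : ℤ → Polynomial ℤ) e1
  have f0 := congrArg (Polynomial.C : ℤ → Polynomial ℤ) e0
  rw [Polynomial.C_mul, Polynomial.C_mul] at f2 f1 f0
  change _ * Polynomial.C (Em (PP mu u v w) n false (s+2+2)) = _ * Polynomial.C (Em (PP mu u v w) n true (s+2+2)) at f2
  change _ * Polynomial.C (Em (PP mu u v w) n false (s+2+1)) = _ * Polynomial.C (Em (PP mu u v w) n true (s+2+1)) at f1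
  change _ * Polynomial.C (Em (PP mu u v w) n false (s+2)) = _ * Polynomial.C (Em (PP mu u v w) n true (s+2)) at f0
  linear_combination (KK u v w) * f2 + 2 * Uz mu * KK u v w * f1 + Uz mu * Uz mu * KK u v w * f0

lemma RS_true (n : ℕ) (mu s : ℕ) (hs : s < 11) (h : 3 * (n % 11) + 3 ≤ s) :
    Polynomial.C 3628800 * RS n false mu s = Polynomial.C (-((n - n % 11 : ℕ) : ℤ)) * RS n true mu s := by
  unfold RS
  simp only [Finset.mul_sum, RT_true n mu s hs h]

lemma row_true (n : ℕ) (hn : 21 ≤ n) (mu s : ℕ) (hs : s < 11) (h : 3 * (n % 11) + 3 ≤ s) (f : Polynomial ℤ →+ ℂ)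
    (h0 : f (RS n false mu s) = 0) : f (RS n true mu s) = 0 := by
  have e := congrArg f (RS_true n mu s hs h)
  rw [← Polynomial.smul_eq_C_mul, ← Polynomial.smul_eq_C_mul, map_zsmul, map_zsmul, h0, smul_zero] at e
  have := smul_eq_zero.1 e.symm
  refine this.resolve_left ?_
  have : n % 11 < 11 := Nat.mod_lt _ (by norm_num)
  omega

/-- degree 8 monomials -/
def mon (j : ℕ) : MvP := X 0 ^ (8 - j % 9 - j / 9) * X 1 ^ (j % 9) * X 2 ^ (j / 9)

def wt (φ : MvP →ₗ[ℂ] ℂ) (j : ℕ) : ℂ := if 9 ≤ j % 9 + j / 9 then 0 else φ (mon j)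

def tphi (φ : MvP →ₗ[ℂ] ℂ) : Polynomial ℤ →ₗ[ℤ] ℂ := (Polynomial.basisMonomials ℤ).constr ℤ (wt φ)

lemma tphi_X (φ : MvP →ₗ[ℂ] ℂ) (j : ℕ) : tphi φ (Polynomial.X ^ j) = wt φ j := by
  have := (Polynomial.basisMonomials ℤ).constr_basis ℤ (wt φ) j
  rw [Polynomial.coe_basisMonomials] at this
  rw [Polynomial.X_pow_eq_monomial]
  exact this

abbrev iC : MvPolynomial (Fin 3) ℤ →+* MvP := MvPolynomial.map (Int.castRingHom ℂ)
abbrev Kr : MvPolynomial (Fin 3) ℤ →ₐ[ℤ] Polynomial ℤ := aeval ![1, Polynomial.X, Polynomial.X ^ 9]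

lemma deg3 (m : Fin 3 →₀ ℕ) : m.degree = m 0 + m 1 + m 2 := by
  rw [Finsupp.degree_eq_sum, Fin.sum_univ_three]

lemma mon_eq (m : Fin 3 →₀ ℕ) (h : m.degree = 8) :
    (monomial m (1 : ℂ) : MvP) = mon (m 1 + 9 * m 2) ∧ ¬ (9 ≤ (m 1 + 9 * m 2) % 9 + (m 1 + 9 * m 2) / 9) := by
  rw [deg3] at h
  have h1 : (m 1 + 9 * m 2) % 9 = m 1 := by omega
  have h2 : (m 1 + 9 * m 2) / 9 = m 2 := by omega
  rw [mon, h1, h2]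
  refine ⟨?_, by omega⟩
  rw [show 8 - m 1 - m 2 = m 0 by omega]
  rw [monomial_eq, Finsupp.prod_fintype _ _ (by simp), Fin.prod_univ_three]
  simp

lemma kron (φ : MvP →ₗ[ℂ] ℂ) (f : MvPolynomial (Fin 3) ℤ) (hf : f.IsHomogeneous 8) :
    φ (iC f) = tphi φ (Kr f) := by
  rw [f.as_sum]
  simp only [map_sum]
  refine Finset.sum_congr rfl fun m hm => ?_
  have hd : m.degree = 8 := by
    by_contra hne
    exact (mem_support_iff.1 hm) (hf.coeff_eq_zero hne)
  obtain ⟨h1, h2⟩ := mon_eq m hd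
  have hL : iC (monomial m (coeff m f)) = ((coeff m f : ℤ) : ℂ) • (monomial m (1 : ℂ) : MvP) := by
    simp [iC, map_monomial, smul_monomial]
  have hR : Kr (monomial m (coeff m f)) = (coeff m f) • (Polynomial.X ^ (m 1 + 9 * m 2) : Polynomial ℤ) := by
    rw [Kr, aeval_monomial, Finsupp.prod_fintype _ _ (by simp), Fin.prod_univ_three]
    simp [Polynomial.smul_eq_C_mul, pow_add, pow_mul]
  rw [hL, hR, map_smul, map_smul, tphi_X, wt, if_neg h2, h1, smul_eq_mul, zsmul_eq_mul]

def Lz (u : Fin 3 → ℤ) : MvPolynomial (Fin 3) ℤ := ∑ i, C (u i) * X i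
lemma Lz_hom (u : Fin 3 → ℤ) : (Lz u).IsHomogeneous 1 := by
  unfold Lz
  apply IsHomogeneous.sum
  intro i _
  simpa using (isHomogeneous_C (Fin 3) (u i)).mul (isHomogeneous_X ℤ i)
lemma Lz_Kr (u : Fin 3 → ℤ) : Kr (Lz u) = Kz u := by
  simp only [Lz, Kz, Fin.sum_univ_three, map_add, map_mul, aeval_X, algHom_C]
  simp [add_assoc]
def cz (u : Fin 3 → ℤ) : Fin 3 → ℂ := fun i => (u i : ℂ)
lemma Lz_iC (u : Fin 3 → ℤ) : iC (Lz u) = lin (cz u) := by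
  simp [Lz, lin, cz]

def yZ (mu : ℕ) : MvPolynomial (Fin 3) ℤ := Lz ![0, 1, (mu : ℤ)]
def yC (mu : ℕ) : MvP := lin ![0, 1, (mu : ℂ)]
lemma yZ_Kr (mu : ℕ) : Kr (yZ mu) = Uz mu := by
  rw [yZ, Lz_Kr]; simp [Kz, Uz]
lemma yZ_iC (mu : ℕ) : iC (yZ mu) = yC mu := by
  rw [yZ, Lz_iC, yC]; congr 1; ext i; fin_cases i <;> simp [cz]

def LLL (u v w : Fin 3 → ℤ) : MvP := lin (cz u) ^ 2 * lin (cz v) ^ 2 * lin (cz w) ^ 2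

lemma LLL_iC (u v w : Fin 3 → ℤ) : iC ((Lz u * (Lz v * Lz w)) ^ 2) = LLL u v w := by
  simp only [map_pow, map_mul, Lz_iC, LLL]; ring
lemma LLL_Kr (u v w : Fin 3 → ℤ) : Kr ((Lz u * (Lz v * Lz w)) ^ 2) = KK u v w := by
  simp only [map_pow, map_mul, Lz_Kr, KK]
lemma LLL_hom (u v w : Fin 3 → ℤ) : ((Lz u * (Lz v * Lz w)) ^ 2).IsHomogeneous 6 := by
  exact ((Lz_hom u).mul ((Lz_hom v).mul (Lz_hom w))).pow 2

lemma k0 (φ : MvP →ₗ[ℂ] ℂ) (u v w : Fin 3 → ℤ) : φ (X 0 ^ 2 * LLL u v w) = tphi φ (KK u v w) := by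
  have := kron φ (X 0 ^ 2 * (Lz u * (Lz v * Lz w)) ^ 2) (((isHomogeneous_X ℤ 0).pow 2).mul (LLL_hom u v w))
  rw [map_mul iC, map_mul Kr, LLL_iC, LLL_Kr] at this
  simpa using this
lemma k1 (φ : MvP →ₗ[ℂ] ℂ) (mu : ℕ) (u v w : Fin 3 → ℤ) : φ (2 * (X 0 * yC mu) * LLL u v w) = tphi φ (2 * Uz mu * KK u v w) := by
  have := kron φ (X 0 * yZ mu * (Lz u * (Lz v * Lz w)) ^ 2) (((isHomogeneous_X ℤ 0).mul (Lz_hom _)).mul (LLL_hom u v w))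
  rw [map_mul iC, map_mul Kr, LLL_iC, LLL_Kr, map_mul iC, map_mul Kr, yZ_iC, yZ_Kr] at this
  have e1 : (2 * (X 0 * yC mu) * LLL u v w : MvP) = (2 : ℕ) • (X 0 * yC mu * LLL u v w) := by rw [nsmul_eq_mul]; push_cast; ring
  have e2 : (2 * Uz mu * KK u v w) = (2 : ℕ) • (Uz mu * KK u v w) := by rw [nsmul_eq_mul]; push_cast; ring
  rw [e1, e2, map_nsmul, map_nsmul]
  congr 1
  simpa using this
lemma k2 (φ : MvP →ₗ[ℂ] ℂ) (mu : ℕ) (u v w : Fin 3 → ℤ) : φ (yC mu * yC mu * LLL u v w) = tphi φ (Uz mu * Uz mu * KK u v w) := by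
  have := kron φ (yZ mu * yZ mu * (Lz u * (Lz v * Lz w)) ^ 2) (((Lz_hom _).mul (Lz_hom _)).mul (LLL_hom u v w))
  rw [map_mul iC, map_mul Kr, LLL_iC, LLL_Kr, map_mul iC, map_mul Kr, yZ_iC, yZ_Kr] at this
  exact this

lemma tphi_RT (φ : MvP →ₗ[ℂ] ℂ) (n : ℕ) (mu s : ℕ) (u v w : Fin 3 → ℤ) (du : Bool) :
    tphi φ (RT n du mu s u v w) = (Em (PP mu u v w) n du (s+2) : ℂ) * φ (X 0 ^ 2 * LLL u v w)
      + (Em (PP mu u v w) n du (s+1) : ℂ) * φ (2 * (X 0 * yC mu) * LLL u v w)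
      + (Em (PP mu u v w) n du s : ℂ) * φ (yC mu * yC mu * LLL u v w) := by
  rw [k0, k1, k2]
  have : RT n du mu s u v w = Em (PP mu u v w) n du (s+2) • KK u v w + Em (PP mu u v w) n du (s+1) • (2 * Uz mu * KK u v w)
    + Em (PP mu u v w) n du s • (Uz mu * Uz mu * KK u v w) := by
    simp only [Polynomial.smul_eq_C_mul, RT]; ring
  rw [this, map_add, map_add, map_smul, map_smul, map_smul]
  simp only [zsmul_eq_mul]

/-- the row polynomial in t -/
def WT (φ : MvP →ₗ[ℂ] ℂ) (n mu : ℕ) (u v w : Fin 3 → ℤ) : Polynomial ℂ :=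
  ((PP mu u v w).map (Int.castRingHom ℂ)) ^ n * (Polynomial.C (φ (X 0 ^ 2 * LLL u v w))
    + (Polynomial.C (φ (2 * (X 0 * yC mu) * LLL u v w)) * Polynomial.X
      + Polynomial.C (φ (yC mu * yC mu * LLL u v w)) * Polynomial.X ^ 2))

lemma WT_coeff (φ : MvP →ₗ[ℂ] ℂ) (n mu s : ℕ) (u v w : Fin 3 → ℤ) :
    (WT φ n mu u v w).coeff s = tphi φ (RT n false mu s u v w) := by
  rw [tphi_RT, WT, ← Polynomial.map_pow]
  simp only [Em, cp, Bool.false_eq_true, if_false]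
  generalize φ (X 0 ^ 2 * LLL u v w) = c0
  generalize φ (2 * (X 0 * yC mu) * LLL u v w) = c1
  generalize φ (yC mu * yC mu * LLL u v w) = c2
  generalize PP mu u v w ^ n = Q
  have e : Q.map (Int.castRingHom ℂ) * (Polynomial.C c0 + (Polynomial.C c1 * Polynomial.X + Polynomial.C c2 * Polynomial.X ^ 2))
    = Polynomial.C c0 * Q.map (Int.castRingHom ℂ) + Polynomial.C c1 * (Q.map (Int.castRingHom ℂ) * Polynomial.X ^ 1)
      + Polynomial.C c2 * (Q.map (Int.castRingHom ℂ) * Polynomial.X ^ 2) := by ring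
  rw [e, Polynomial.coeff_add, Polynomial.coeff_add, Polynomial.coeff_C_mul, Polynomial.coeff_C_mul, Polynomial.coeff_C_mul,
    Polynomial.coeff_mul_X_pow', Polynomial.coeff_mul_X_pow']
  match s with
  | 0 => simp [mul_comm]
  | 1 => simp [mul_comm]
  | s+2 =>
    simp [mul_comm]

lemma lin_t (mu : ℕ) (t : ℂ) : lin ![1, t, t * mu] = X 0 + C t * yC mu := by
  simp only [lin, yC, Fin.sum_univ_three]
  simp [C_mul]
  ring

lemma br_t (mu : ℕ) (t : ℂ) (u v : Fin 3 → ℤ) : br ![1, t, t * mu] (cz u) (cz v) = zA u v + t * zB mu u v := by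
  simp only [br, Matrix.det_fin_three, zA, zB]
  simp [cz]
  ring
lemma br_c (u v w : Fin 3 → ℤ) : br (cz u) (cz v) (cz w) = zD u v w := by
  simp only [br, Matrix.det_fin_three, zD]
  simp [cz]
  ring
lemma icov_t (mu : ℕ) (t : ℂ) (u v w : Fin 3 → ℤ) :
    Icov ![1, t, t * mu] (cz u) (cz v) (cz w) = ((PP mu u v w).map (Int.castRingHom ℂ)).eval t := by
  rw [Icov, br_t, br_t, br_t, br_c, PP, cub_map, cub]
  simp only [Polynomial.eval_add, Polynomial.eval_mul, Polynomial.eval_C, Polynomial.eval_X, Polynomial.eval_pow, zp0,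
    eq_intCast]
  push_cast
  ring

lemma WT_eval (φ : MvP →ₗ[ℂ] ℂ) (n mu : ℕ) (t : ℂ) (u v w : Fin 3 → ℤ) :
    (WT φ n mu u v w).eval t = Icov ![1, t, t * mu] (cz u) (cz v) (cz w) ^ n *
      φ (lin ![1, t, t * mu] ^ 2 * lin (cz u) ^ 2 * lin (cz v) ^ 2 * lin (cz w) ^ 2) := by
  rw [icov_t, WT, lin_t]
  have e : ((X 0 + C t * yC mu) ^ 2 * lin (cz u) ^ 2 * lin (cz v) ^ 2 * lin (cz w) ^ 2 : MvP)
    = X 0 ^ 2 * LLL u v w + (t • (2 * (X 0 * yC mu) * LLL u v w) + t ^ 2 • (yC mu * yC mu * LLL u v w)) := by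
    simp only [smul_eq_C_mul, C_pow, LLL]; ring
  rw [e, map_add, map_add, map_smul, map_smul]
  simp only [Polynomial.eval_mul, Polynomial.eval_pow, Polynomial.eval_add, Polynomial.eval_C, Polynomial.eval_X, smul_eq_mul]
  ring

end Kron

section Fin19

lemma ms_eq (i : Fin 9) : ms i = cz (mz i) := by
  have h : mz i = mtab i := by
    unfold mz
    congr 1
    ext
    simp [Fin.ofNat, Nat.mod_eq_of_lt i.2]
  ext j
  rw [h]
  fin_cases i <;> fin_cases j <;> simp [ms, cz, mtab]

lemma Psi_lin {d : ℕ} (Ψ : MultilinearMap ℂ (fun _ : Fin 4 => V d) (V 8)) (g : V d) :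
    ∃ L : V d →ₗ[ℂ] V 8, ∀ h, L h = Ψ ![h, g, g, g] := by
  refine ⟨Ψ.toLinearMap ![0, g, g, g] 0, fun h => ?_⟩
  rw [MultilinearMap.toLinearMap_apply]
  congr 1
  ext i
  fin_cases i <;> rfl

lemma Psi_sum {d : ℕ} (Ψ : MultilinearMap ℂ (fun _ : Fin 4 => V d) (V 8)) (h : V d) (b : Fin 9 → V d) :
    Ψ ![h, ∑ i, b i, ∑ i, b i, ∑ i, b i] = ∑ i, ∑ k, ∑ q, Ψ ![h, b i, b k, b q] := by
  have h1 : ∀ x y z w : V d, Ψ ![x, y, z, w] = Ψ.toLinearMap ![x, 0, z, w] 1 y := fun x y z w => by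
    rw [MultilinearMap.toLinearMap_apply]; congr 1; ext i; fin_cases i <;> rfl
  have h2 : ∀ x y z w : V d, Ψ ![x, y, z, w] = Ψ.toLinearMap ![x, y, 0, w] 2 z := fun x y z w => by
    rw [MultilinearMap.toLinearMap_apply]; congr 1; ext i; fin_cases i <;> rfl
  have h3 : ∀ x y z w : V d, Ψ ![x, y, z, w] = Ψ.toLinearMap ![x, y, z, 0] 3 w := fun x y z w => by
    rw [MultilinearMap.toLinearMap_apply]; congr 1; ext i; fin_cases i <;> rfl
  have s1 : ∀ x z w, Ψ ![x, ∑ i, b i, z, w] = ∑ i, Ψ ![x, b i, z, w] := fun x z w => by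
    rw [h1, map_sum]; exact Finset.sum_congr rfl fun i _ => (h1 _ _ _ _).symm
  have s2 : ∀ x z w, Ψ ![x, z, ∑ i, b i, w] = ∑ i, Ψ ![x, z, b i, w] := fun x z w => by
    rw [h2, map_sum]; exact Finset.sum_congr rfl fun i _ => (h2 _ _ _ _).symm
  have s3 : ∀ x z w, Ψ ![x, z, w, ∑ i, b i] = ∑ i, Ψ ![x, z, w, b i] := fun x z w => by
    rw [h3, map_sum]; exact Finset.sum_congr rfl fun i _ => (h3 _ _ _ _).symm
  rw [s1]
  refine Finset.sum_congr rfl fun i _ => ?_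
  rw [s2]
  refine Finset.sum_congr rfl fun k _ => ?_
  rw [s3]

lemma yC_hom (mu : ℕ) : (yC mu).IsHomogeneous 1 := lin_hom _

/-- the t^s part of l_t^d -/
def hs (d mu s : ℕ) (h : s ≤ d) : V d :=
  ⟨(d.choose s : ℂ) • (X 0 ^ (d - s) * yC mu ^ s), by
    apply Submodule.smul_mem
    rw [V, mem_homogeneousSubmodule]
    have := ((isHomogeneous_X ℂ (0 : Fin 3)).pow (d - s)).mul ((yC_hom mu).pow s)
    rwa [show 1 * (d - s) + 1 * s = d by omega] at this⟩

lemma powV_t (d mu : ℕ) (t : ℂ) : powV d ![1, t, t * mu]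
    = ∑ s : Fin (d+1), t ^ (s : ℕ) • hs d mu s (by omega) := by
  apply Subtype.ext
  rw [AddSubmonoidClass.coe_finsetSum]
  change lin _ ^ d = ∑ s : Fin (d+1), t ^ (s : ℕ) • ((d.choose s : ℂ) • (X 0 ^ (d - s) * yC mu ^ (s : ℕ)))
  rw [lin_t, add_comm, add_pow, Finset.sum_range]
  refine Finset.sum_congr rfl fun s _ => ?_
  rw [smul_eq_C_mul, smul_eq_C_mul, C_pow, mul_pow]
  simp only [map_natCast]
  ring

lemma hs_mem (n mu s : ℕ) (hn : 21 ≤ n) (h : s ≤ 3*n+2) (h10 : s < 11) : memLT n (hs (3*n+2) mu s h) := by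
  unfold memLT
  change _ ∣ ((3*n+2).choose s : ℂ) • (X 0 ^ (3*n+2 - s) * yC mu ^ s)
  rw [smul_eq_C_mul]
  exact dvd_mul_of_dvd_right (dvd_mul_of_dvd_left (pow_dvd_pow _ (by omega)) _) _

theorem rows_zero (n : ℕ) (hn : 21 ≤ n)
    (Ψ : MultilinearMap ℂ (fun _ : Fin 4 => V (3*n+2)) (V 8)) (hΨ : IsClebschT n Ψ)
    (g : V (3*n+2)) (hg : g = ∑ i, powV (3*n+2) (ms i)) (φ : MvP →ₗ[ℂ] ℂ)
    (hφ : ∀ h, memLT n h → φ (Ψ ![h, g, g, g] : V 8) = 0) (mu s : ℕ) (h10 : s < 11) :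
    tphi φ (RS n false mu s) = 0 := by
  obtain ⟨L, hL⟩ := Psi_lin Ψ g
  have hA : ∀ t : ℂ, φ (L (powV (3*n+2) ![1, t, t * mu]) : V 8) =
      (∑ s : Fin (3*n+2+1), Polynomial.C (φ (L (hs (3*n+2) mu s (by omega)) : V 8)) * Polynomial.X ^ (s : ℕ)).eval t := by
    intro t
    rw [powV_t, map_sum, AddSubmonoidClass.coe_finsetSum, map_sum, Polynomial.eval_finsetSum]
    refine Finset.sum_congr rfl fun s _ => ?_
    rw [map_smul, Submodule.coe_smul, map_smul]
    simp only [Polynomial.eval_mul, Polynomial.eval_C, Polynomial.eval_pow, Polynomial.eval_X, smul_eq_mul]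
    rw [mul_comm]
  have hB : ∀ t : ℂ, φ (L (powV (3*n+2) ![1, t, t * mu]) : V 8) =
      (∑ i ∈ Finset.range 9, ∑ k ∈ Finset.range 9, ∑ q ∈ Finset.range 9, WT φ n mu (mz i) (mz k) (mz q)).eval t := by
    intro t
    rw [hL, hg, Psi_sum]
    simp only [Polynomial.eval_finsetSum, Finset.sum_range, WT_eval, AddSubmonoidClass.coe_finsetSum, map_sum]
    refine Finset.sum_congr rfl fun i _ => Finset.sum_congr rfl fun k _ => Finset.sum_congr rfl fun q _ => ?_
    rw [hΨ.2, Submodule.coe_smul, map_smul, ms_eq, ms_eq, ms_eq]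
    rfl
  have hC : (∑ s : Fin (3*n+2+1), Polynomial.C (φ (L (hs (3*n+2) mu s (by omega)) : V 8)) * Polynomial.X ^ (s : ℕ))
      = ∑ i ∈ Finset.range 9, ∑ k ∈ Finset.range 9, ∑ q ∈ Finset.range 9, WT φ n mu (mz i) (mz k) (mz q) :=
    Polynomial.funext fun t => (hA t).symm.trans (hB t)
  have hD := congrArg (fun p => Polynomial.coeff p s) hC
  simp only [Polynomial.finsetSum_coeff, WT_coeff, Polynomial.coeff_C_mul, Polynomial.coeff_X_pow] at hD
  rw [RS]
  simp only [map_sum]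
  rw [← hD]
  apply Finset.sum_eq_zero
  intro j _
  split_ifs with hj
  · rw [hL, hφ _ (hs_mem n mu j hn (by omega) (by omega)), zero_mul]
  · rw [mul_zero]

theorem phi_zero (φ : MvP →ₗ[ℂ] ℂ) (h : ∀ p, tphi φ p = 0) (v : V 8) : φ (v : MvP) = 0 := by
  obtain ⟨v, hv⟩ := v
  change φ v = 0
  rw [V, mem_homogeneousSubmodule] at hv
  rw [v.as_sum, map_sum]
  refine Finset.sum_eq_zero fun m hm => ?_
  have hd : m.degree = 8 := by
    by_contra hne
    exact (mem_support_iff.1 hm) (hv.coeff_eq_zero hne)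
  obtain ⟨h1, h2⟩ := mon_eq m hd
  have hL : (monomial m (coeff m v) : MvP) = coeff m v • (monomial m (1 : ℂ) : MvP) := by
    simp [smul_monomial]
  have := h (Polynomial.X ^ (m 1 + 9 * m 2))
  rw [tphi_X, wt, if_neg h2] at this
  rw [hL, map_smul, h1, this, smul_zero]

end Fin19


theorem stmt19 (n : ℕ) (hn : 21 ≤ n)
    (Ψ : MultilinearMap ℂ (fun _ : Fin 4 => V (3*n+2)) (V 8)) (hΨ : IsClebschT n Ψ)
    (g : V (3*n+2)) (hg : g = ∑ i, powV (3*n+2) (ms i)) :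
    Submodule.span ℂ
      (((fun h => Ψ ![h, g, g, g]) '' {h : V (3*n+2) | memLT n h}) ∪ {Ψ ![g, g, g, g]})
      = ⊤ := by
  by_contra hne
  obtain ⟨f, hf0, hf⟩ := Submodule.exists_le_ker_of_lt_top _ (lt_top_iff_ne_top.2 hne)
  obtain ⟨φ, hφ⟩ := LinearMap.exists_extend f
  have hφ' : ∀ v : V 8, φ (v : MvP) = f v := fun v => by rw [← hφ]; rfl
  apply hf0
  ext v
  rw [← hφ', LinearMap.zero_apply]
  apply phi_zero
  have hfalse : ∀ mu s, s < 11 → tphi φ (RS n false mu s) = 0 := fun mu s hs =>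
    rows_zero n hn Ψ hΨ g hg φ (fun h hh => by
      rw [hφ']
      exact hf (Submodule.subset_span (Or.inl ⟨h, hh, rfl⟩))) mu s hs
  obtain ⟨F, hF⟩ : ∃ F : Polynomial ℤ →+ ℂ, ∀ p, F p = tphi φ p := ⟨(tphi φ).toAddMonoidHom, fun _ => rfl⟩
  have hcore := core n hn F (fun i hi => by rw [hF, tphi_X, wt, if_pos hi]) (fun du mu s _ hs hd => by
    have h0 : F (RS n false mu s) = 0 := (hF _).trans (hfalse mu s hs)
    cases du with
    | false => exact h0
    | true => exact row_true n hn mu s hs (hd rfl) F h0)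
  intro p
  rw [← hF]
  exact hcore p
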